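/- arXiv:1512.04069 — 4 statements merged into one kernel-verified Lean document; each statement's English description precedes it below -/
import Mathlib

section
/- Let p > 1 and let q satisfy 1/p + 1/q = 1, let σ ∈ ℝ, and let h be a nonnegative Lebesgue-measurable function on (0,∞) with k(σ) := ∫₀^∞ h(t) t^{σ-1} dt satisfying 0 < k(σ) < ∞. Let f, g be nonnegative measurable functions on (0,∞) such that 0 < ∫₀^∞ x^{p(1-σ)-1} f(x)^p dx < ∞ and 0 < ∫₀^∞ y^{q(1-σ)-1} g(y)^q dy < ∞. Then ∫₀^∞ ∫₀^∞ h(x·y) f(x) g(y) dx dy < k(σ) · (∫₀^∞ x^{p(1-σ)-1} f(x)^p dx)^{1/p} · (∫₀^∞ y^{q(1-σ)-1} g(y)^q dy)^{1/q}. -/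
open MeasureTheory Set

theorem Real.eq_of_rpow_mul_rpow_eq {a b w z : ℝ} (ha : 0 < a) (hb : 0 < b) (hab : a + b = 1)
    (hw : 0 ≤ w) (hz : 0 ≤ z) (h : w ^ a * z ^ b = a * w + b * z) : w = z := by
  have key := Real.geom_mean_eq_arith_mean_weighted_iff_of_pos Finset.univ ![a, b] ![w, z]
    (by simp [Fin.forall_fin_two, ha, hb]) (by simpa using hab)
    (by simp [Fin.forall_fin_two, hw, hz])
  simp only [Fin.prod_univ_two, Fin.sum_univ_two, Matrix.cons_val_zero, Matrix.cons_val_one] at key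
  simpa using key.1 h 0 (Finset.mem_univ _) 1 (Finset.mem_univ _)

theorem ENNReal.ofReal_rpow_mul_rpow {a b : ℝ} (ha : 0 < a) (hb : 0 < b) {w z : ℝ}
    (hw : 0 ≤ w) (hz : 0 ≤ z) :
    ENNReal.ofReal w ^ a * ENNReal.ofReal z ^ b = ENNReal.ofReal (w ^ a * z ^ b) := by
  rw [ENNReal.ofReal_rpow_of_nonneg hw ha.le, ENNReal.ofReal_rpow_of_nonneg hz hb.le,
    ENNReal.ofReal_mul (by positivity)]

/-- Two probability densities whose weighted geometric mean also has integral one agree. -/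
theorem ae_eq_of_lintegral_rpow_mul_rpow {α : Type*} [MeasurableSpace α] {μ : Measure α}
    {a b : ℝ} (ha : 0 < a) (hb : 0 < b) (hab : a + b = 1) {w z : α → ENNReal}
    (hw : Measurable w) (hz : Measurable z) (hw1 : ∫⁻ x, w x ∂μ = 1) (hz1 : ∫⁻ x, z x ∂μ = 1)
    (h : ∫⁻ x, w x ^ a * z x ^ b ∂μ = 1) : w =ᵐ[μ] z := by
  have hwf := ae_lt_top (μ := μ) hw (by simp [hw1])
  have hzf := ae_lt_top (μ := μ) hz (by simp [hz1])
  have amgm : (fun x ↦ w x ^ a * z x ^ b) =ᵐ[μ]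
      fun x ↦ ENNReal.ofReal a * w x + ENNReal.ofReal b * z x := by
    refine ae_eq_of_ae_le_of_lintegral_le ?_ (by simp [h]) (by fun_prop) ?_
    · filter_upwards [hwf, hzf] with x hwx hzx
      have := Real.geom_mean_le_arith_mean2_weighted ha.le hb.le
        (ENNReal.toReal_nonneg (a := w x)) (ENNReal.toReal_nonneg (a := z x)) hab
      rw [← ENNReal.ofReal_toReal hwx.ne, ← ENNReal.ofReal_toReal hzx.ne,
        ENNReal.ofReal_rpow_mul_rpow ha hb ENNReal.toReal_nonneg ENNReal.toReal_nonneg,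
        ← ENNReal.ofReal_mul ha.le, ← ENNReal.ofReal_mul hb.le,
        ← ENNReal.ofReal_add (by positivity) (by positivity)]
      exact ENNReal.ofReal_le_ofReal this
    · rw [lintegral_add_left (by fun_prop), lintegral_const_mul _ hw, lintegral_const_mul _ hz,
        hw1, hz1, h, mul_one, mul_one, ← ENNReal.ofReal_add ha.le hb.le, hab, ENNReal.ofReal_one]
  filter_upwards [hwf, hzf, amgm] with x hwx hzx hx
  rw [← ENNReal.ofReal_toReal hwx.ne, ← ENNReal.ofReal_toReal hzx.ne,
    ENNReal.ofReal_rpow_mul_rpow ha hb ENNReal.toReal_nonneg ENNReal.toReal_nonneg,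
    ← ENNReal.ofReal_mul ha.le, ← ENNReal.ofReal_mul hb.le,
    ← ENNReal.ofReal_add (by positivity) (by positivity),
    ENNReal.ofReal_eq_ofReal_iff (by positivity) (by positivity)] at hx
  rw [← ENNReal.ofReal_toReal hwx.ne, ← ENNReal.ofReal_toReal hzx.ne,
    Real.eq_of_rpow_mul_rpow_eq ha hb hab ENNReal.toReal_nonneg ENNReal.toReal_nonneg hx]

/-- The equality case of Hölder's inequality. -/
theorem ae_eq_of_lintegral_mul_eq_Lp_mul_Lq {α : Type*} [MeasurableSpace α] {μ : Measure α}
    {p q : ℝ} (hpq : p.HolderConjugate q) {u v : α → ENNReal} (hu : Measurable u)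
    (hv : Measurable v) {A B : ENNReal} (hA : ∫⁻ x, u x ^ p ∂μ = A) (hB : ∫⁻ x, v x ^ q ∂μ = B)
    (hA0 : A ≠ 0) (hAt : A ≠ ⊤) (hB0 : B ≠ 0) (hBt : B ≠ ⊤)
    (h : ∫⁻ x, u x * v x ∂μ = A ^ (1 / p) * B ^ (1 / q)) :
    (fun x ↦ u x ^ p / A) =ᵐ[μ] fun x ↦ v x ^ q / B := by
  have hp := hpq.pos
  have hq := hpq.symm.pos
  have norm_rpow {r : ℝ} (hr : 0 < r) (s c : ENNReal) :
      (s ^ r / c) ^ (1 / r) = s * (c ^ (1 / r))⁻¹ := by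
    rw [ENNReal.div_rpow_of_nonneg _ _ (by positivity), ← ENNReal.rpow_mul,
      mul_one_div_cancel hr.ne', ENNReal.rpow_one, div_eq_mul_inv]
  refine ae_eq_of_lintegral_rpow_mul_rpow (a := 1 / p) (b := 1 / q) (by positivity)
    (by positivity) (by simpa using hpq.inv_add_inv_eq_one) (by fun_prop) (by fun_prop) ?_ ?_ ?_
  · simp only [div_eq_mul_inv]
    rw [lintegral_mul_const _ (by fun_prop), hA, ENNReal.mul_inv_cancel hA0 hAt]
  · simp only [div_eq_mul_inv]
    rw [lintegral_mul_const _ (by fun_prop), hB, ENNReal.mul_inv_cancel hB0 hBt]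
  · have hA' : A ^ (1 / p) ≠ 0 := by simp [ENNReal.rpow_eq_zero_iff, hA0, hAt]
    have hB' : B ^ (1 / q) ≠ 0 := by simp [ENNReal.rpow_eq_zero_iff, hB0, hBt]
    have hAt' : A ^ (1 / p) ≠ ⊤ := ENNReal.rpow_ne_top_of_nonneg (by positivity) hAt
    have hBt' : B ^ (1 / q) ≠ ⊤ := ENNReal.rpow_ne_top_of_nonneg (by positivity) hBt
    simp only [norm_rpow hp, norm_rpow hq, mul_mul_mul_comm]
    rw [lintegral_mul_const _ (by fun_prop), h, mul_mul_mul_comm,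
      ENNReal.mul_inv_cancel hA' hAt', ENNReal.mul_inv_cancel hB' hBt', one_mul]

/-- The Haar measure `dx / x` of the multiplicative group of positive reals. -/
noncomputable def mulHaarIoi : Measure ℝ :=
  (volume.restrict (Ioi 0)).withDensity fun x ↦ ENNReal.ofReal x⁻¹

instance : SigmaFinite mulHaarIoi := by
  unfold mulHaarIoi
  infer_instance

theorem mulHaarIoi_absolutelyContinuous : mulHaarIoi ≪ volume.restrict (Ioi 0) :=
  withDensity_absolutelyContinuous _ _

theorem ae_mulHaarIoi_pos : ∀ᵐ x ∂mulHaarIoi, 0 < x :=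
  mulHaarIoi_absolutelyContinuous (ae_restrict_mem measurableSet_Ioi)

theorem mulHaarIoi_singleton (t : ℝ) : mulHaarIoi {t} = 0 :=
  mulHaarIoi_absolutelyContinuous (measure_singleton t)

theorem lintegral_mulHaarIoi {F : ℝ → ENNReal} (hF : Measurable F) :
    ∫⁻ x, F x ∂mulHaarIoi = ∫⁻ x in Ioi 0, ENNReal.ofReal x⁻¹ * F x :=
  lintegral_withDensity_eq_lintegral_mul _ (by fun_prop) hF

theorem measurePreserving_const_div {t : ℝ} (ht : 0 < t) :
    MeasurePreserving (fun y ↦ t / y) mulHaarIoi mulHaarIoi := by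
  have hm : Measurable fun y : ℝ ↦ t / y := by fun_prop
  refine ⟨hm, Measure.ext_of_lintegral _ fun F hF ↦ ?_⟩
  have himage : (fun y ↦ t / y) '' Ioi 0 = Ioi 0 := by
    ext x
    refine ⟨fun ⟨y, hy, hyx⟩ ↦ hyx ▸ div_pos ht hy, fun hx ↦ ⟨t / x, div_pos ht hx, ?_⟩⟩
    simp [ht.ne']
  have hderiv (y : ℝ) (hy : y ∈ Ioi (0 : ℝ)) :
      HasDerivWithinAt (fun y ↦ t / y) (-t / y ^ 2) (Ioi 0) y := by
    have := ((hasDerivAt_inv (ne_of_gt hy)).const_mul t).hasDerivWithinAt (s := Ioi 0)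
    convert! this using 1
    ring
  have hinj : InjOn (fun y ↦ t / y) (Ioi 0) := fun y _ z _ hyz ↦
    inv_injective (mul_left_cancel₀ ht.ne' hyz)
  rw [lintegral_map hF hm, lintegral_mulHaarIoi hF, lintegral_mulHaarIoi (F := fun y ↦ F (t / y)) (by fun_prop)]
  nth_rw 2 [← himage]
  rw [lintegral_image_eq_lintegral_abs_deriv_mul measurableSet_Ioi hderiv hinj]
  refine setLIntegral_congr_fun measurableSet_Ioi fun y (hy : 0 < y) ↦ ?_
  rw [← mul_assoc, ← ENNReal.ofReal_mul (abs_nonneg _), neg_div, abs_neg,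
    abs_of_pos (by positivity)]
  congr 2
  field_simp

theorem measurePreserving_mul_const {c : ℝ} (hc : 0 < c) :
    MeasurePreserving (fun x ↦ x * c) mulHaarIoi mulHaarIoi := by
  convert (measurePreserving_const_div hc).comp (measurePreserving_const_div one_pos) using 1
  ext x
  simp [mul_comm]

/-- A multiplicatively periodic function that is integrable with respect to `dx / x` vanishes. -/
theorem lintegral_mulHaarIoi_eq_zero_of_periodic {Φ : ℝ → ENNReal} (hΦ : Measurable Φ)
    (hfin : ∫⁻ x, Φ x ∂mulHaarIoi ≠ ⊤) {r : ℝ} (hr : 1 < r)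
    (hper : ∀ᵐ x ∂mulHaarIoi, Φ (x * r) = Φ x) : ∫⁻ x, Φ x ∂mulHaarIoi = 0 := by
  have hr0 : 0 < r := one_pos.trans hr
  set μ := mulHaarIoi.withDensity Φ with hμ
  have : IsFiniteMeasure μ := isFiniteMeasure_withDensity hfin
  have scale (a : ℝ) : μ (Ioi (a * r)) = μ (Ioi a) := by
    have hpre : (fun x ↦ x * r) ⁻¹' Ioi (a * r) = Ioi a := by
      ext x
      simp [mul_lt_mul_iff_left₀ hr0]
    rw [hμ, withDensity_apply _ measurableSet_Ioi, withDensity_apply _ measurableSet_Ioi,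
      ← (measurePreserving_mul_const hr0).setLIntegral_comp_preimage measurableSet_Ioi hΦ, hpre]
    exact lintegral_congr_ae (ae_restrict_of_ae hper)
  have scale_pow (a : ℝ) (n : ℕ) : μ (Ioi (a * r ^ n)) = μ (Ioi a) := by
    induction n with
    | zero => simp
    | succ n ih => rw [pow_succ, ← mul_assoc, scale, ih]
  have null (a : ℝ) (ha : 0 < a) : μ (Ioi a) = 0 := by
    have hlim : Filter.Tendsto (fun n : ℕ ↦ a * r ^ n) Filter.atTop Filter.atTop :=
      (tendsto_pow_atTop_atTop_of_one_lt hr).const_mul_atTop ha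
    have hinter : ⋂ n : ℕ, Ioi (a * r ^ n) = ∅ := by
      refine eq_empty_of_forall_notMem fun x hx ↦ ?_
      obtain ⟨n, hn⟩ := (hlim.eventually_ge_atTop x).exists
      exact (mem_iInter.1 hx n).not_ge hn
    have htend := tendsto_measure_iInter_atTop (μ := μ) (s := fun n : ℕ ↦ Ioi (a * r ^ n))
      (fun n ↦ measurableSet_Ioi.nullMeasurableSet)
      (fun m n hmn ↦ Ioi_subset_Ioi (by gcongr; exact hr.le)) ⟨0, measure_ne_top _ _⟩
    simp only [Function.comp_def, scale_pow, hinter, measure_empty] at htend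
    exact tendsto_nhds_unique tendsto_const_nhds htend
  have hae : ∀ᵐ x ∂μ, x ≤ 0 := by
    have hn : ∀ᵐ x ∂μ, ∀ n : ℕ, x ≤ 1 / ((n : ℝ) + 1) := ae_all_iff.2 fun n ↦ by
      have := null (1 / ((n : ℝ) + 1)) (by positivity)
      simpa [ae_iff, Ioi_def] using this
    filter_upwards [hn] with x hx
    by_contra! h0
    obtain ⟨n, hn⟩ := exists_nat_one_div_lt h0
    exact (hx n).not_gt hn
  have hpos : ∀ᵐ x ∂μ, 0 < x := withDensity_absolutelyContinuous _ _ ae_mulHaarIoi_pos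
  have huniv : μ univ = 0 := by
    rw [Measure.measure_univ_eq_zero, ← ae_eq_bot, ← Filter.eventually_false_iff_eq_bot]
    filter_upwards [hae, hpos] with x h1 h2 using h1.not_gt h2
  rwa [hμ, withDensity_apply _ MeasurableSet.univ, setLIntegral_univ] at huniv

/-- The Hilbert-type inequality for a kernel `H (x * y)`, in multiplicatively invariant form. -/
theorem lintegral_kernel_mul_lt {p q : ℝ} (hpq : p.HolderConjugate q) {H P Q : ℝ → ENNReal}
    (hH : Measurable H) (hP : Measurable P) (hQ : Measurable Q)
    (hH0 : ∫⁻ t, H t ∂mulHaarIoi ≠ 0) (hHt : ∫⁻ t, H t ∂mulHaarIoi ≠ ⊤)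
    (hP0 : ∫⁻ x, P x ^ p ∂mulHaarIoi ≠ 0) (hPt : ∫⁻ x, P x ^ p ∂mulHaarIoi ≠ ⊤)
    (hQ0 : ∫⁻ y, Q y ^ q ∂mulHaarIoi ≠ 0) (hQt : ∫⁻ y, Q y ^ q ∂mulHaarIoi ≠ ⊤) :
    ∫⁻ y, ∫⁻ x, H (x * y) * P x * Q y ∂mulHaarIoi ∂mulHaarIoi <
      (∫⁻ t, H t ∂mulHaarIoi) * (∫⁻ x, P x ^ p ∂mulHaarIoi) ^ (1 / p) *
        (∫⁻ y, Q y ^ q ∂mulHaarIoi) ^ (1 / q) := by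
  set A := ∫⁻ x, P x ^ p ∂mulHaarIoi with hA
  set B := ∫⁻ y, Q y ^ q ∂mulHaarIoi with hB
  set C := A ^ (1 / p) * B ^ (1 / q) with hC
  have hp := hpq.pos
  have hq := hpq.symm.pos
  have hCt : C ≠ ⊤ := ENNReal.mul_ne_top (ENNReal.rpow_ne_top_of_nonneg (by positivity) hPt)
    (ENNReal.rpow_ne_top_of_nonneg (by positivity) hQt)
  have hPdiv (t : ℝ) : Measurable fun y ↦ P (t / y) := by fun_prop
  let J : ℝ → ENNReal := fun t ↦ ∫⁻ y, P (t / y) * Q y ∂mulHaarIoi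
  have hJm : Measurable J := by
    refine Measurable.lintegral_prod_right' (f := fun z : ℝ × ℝ ↦ P (z.1 / z.2) * Q z.2) ?_
    fun_prop
  have norm_P (t : ℝ) (ht : 0 < t) : ∫⁻ y, P (t / y) ^ p ∂mulHaarIoi = A :=
    (measurePreserving_const_div ht).lintegral_comp (f := fun x ↦ P x ^ p) (by fun_prop)
  have hJle (t : ℝ) (ht : 0 < t) : J t ≤ C := by
    have := ENNReal.lintegral_mul_le_Lp_mul_Lq mulHaarIoi hpq (hPdiv t).aemeasurable
      hQ.aemeasurable
    rwa [norm_P t ht] at this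
  have hJeq (s t : ℝ) (hs : 0 < s) (hst : s < t) (hJs : J s = C) (hJt : J t = C) : False := by
    have hPs := ae_eq_of_lintegral_mul_eq_Lp_mul_Lq hpq (hPdiv s) hQ (norm_P s hs) hB.symm
      hP0 hPt hQ0 hQt hJs
    have hPt' := ae_eq_of_lintegral_mul_eq_Lp_mul_Lq hpq (hPdiv t) hQ (norm_P t (hs.trans hst))
      hB.symm hP0 hPt hQ0 hQt hJt
    refine hP0 (lintegral_mulHaarIoi_eq_zero_of_periodic (Φ := fun x ↦ P x ^ p) (by fun_prop) hPt
      ((one_lt_div hs).2 hst) ?_)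
    filter_upwards [(measurePreserving_const_div hs).quasiMeasurePreserving.ae
      (hPt'.trans hPs.symm), ae_mulHaarIoi_pos] with x hx hx0
    have h1 : t / (s / x) = x * (t / s) := by field_simp
    have h2 : s / (s / x) = x := by field_simp
    rw [h1, h2] at hx
    have hxA := congrArg (· * A) hx
    simpa only [ENNReal.div_mul_cancel hP0 hPt] using hxA
  have hswap : ∫⁻ y, ∫⁻ x, H (x * y) * P x * Q y ∂mulHaarIoi ∂mulHaarIoi =
      ∫⁻ t, H t * J t ∂mulHaarIoi := by
    have hinner : ∀ᵐ y ∂mulHaarIoi, ∫⁻ x, H (x * y) * P x * Q y ∂mulHaarIoi =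
        ∫⁻ t, H t * (P (t / y) * Q y) ∂mulHaarIoi := by
      filter_upwards [ae_mulHaarIoi_pos] with y hy
      rw [← (measurePreserving_mul_const hy).lintegral_comp
        (f := fun t ↦ H t * (P (t / y) * Q y)) (by fun_prop)]
      simp [mul_assoc, hy.ne']
    rw [lintegral_congr_ae hinner, lintegral_lintegral_swap (by fun_prop)]
    exact lintegral_congr fun t ↦ lintegral_const_mul _ (by fun_prop)
  have hle : (fun t ↦ H t * J t) ≤ᵐ[mulHaarIoi] fun t ↦ H t * C := by
    filter_upwards [ae_mulHaarIoi_pos] with t ht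
    gcongr
    exact hJle t ht
  have hHC : ∫⁻ t, H t * C ∂mulHaarIoi = (∫⁻ t, H t ∂mulHaarIoi) * C := lintegral_mul_const _ hH
  rw [hswap, mul_assoc, ← hC, ← hHC]
  by_contra! hge
  have heq := ae_eq_of_ae_le_of_lintegral_le hle
    (ne_top_of_le_ne_top (hHC ▸ ENNReal.mul_ne_top hHt hCt) (lintegral_mono_ae hle))
    (by fun_prop) hge
  have hHfin := ae_lt_top hH hHt
  have hexists (s : ℝ) : ∃ t, t ≠ s ∧ 0 < t ∧ J t = C := by
    by_contra! hnone
    refine hH0 ((lintegral_eq_zero_iff hH).2 ?_)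
    filter_upwards [heq, hHfin, ae_mulHaarIoi_pos,
      compl_mem_ae_iff.2 (mulHaarIoi_singleton s)] with t ht htfin ht0 hts
    by_contra hHt0
    exact hnone t hts ht0 ((ENNReal.mul_right_inj hHt0 htfin.ne).1 ht)
  obtain ⟨s, -, hs, hJs⟩ := hexists 0
  obtain ⟨t, hts, ht, hJt⟩ := hexists s
  rcases hts.lt_or_gt with h | h
  · exact hJeq t s ht h hJt hJs
  · exact hJeq s t hs h hJs hJt

theorem ofReal_inv_mul_ofReal_rpow {r σ x y : ℝ} (hr : 0 < r) (hx : 0 < x) (hy : 0 ≤ y) :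
    ENNReal.ofReal x⁻¹ * ENNReal.ofReal (x ^ (1 - σ) * y) ^ r =
      ENNReal.ofReal (x ^ (r * (1 - σ) - 1) * y ^ r) := by
  rw [ENNReal.ofReal_rpow_of_nonneg (by positivity) hr.le, ← ENNReal.ofReal_mul (by positivity),
    Real.mul_rpow (by positivity) hy, ← Real.rpow_mul hx.le, ← mul_assoc, ← Real.rpow_neg_one x,
    ← Real.rpow_add hx]
  ring_nf

/-- Yang–Hilbert-type integral inequality with non-homogeneous kernel `h(xy)`:
`∫₀^∞∫₀^∞ h(xy) f(x) g(y) dx dy < k(σ) (∫₀^∞ x^{p(1-σ)-1} f^p)^{1/p} (∫₀^∞ y^{q(1-σ)-1} g^q)^{1/q}`. -/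
theorem stmt2 (p q σ : ℝ) (hp : 1 < p) (hpq : 1 / p + 1 / q = 1)
    (h : ℝ → ℝ) (hh : Measurable h) (hh0 : ∀ t ∈ Ioi (0 : ℝ), 0 ≤ h t)
    (hk0 : 0 < ∫⁻ t in Ioi (0 : ℝ), ENNReal.ofReal (h t * t ^ (σ - 1)))
    (hk1 : (∫⁻ t in Ioi (0 : ℝ), ENNReal.ofReal (h t * t ^ (σ - 1))) < ⊤)
    (f g : ℝ → ℝ) (hf : Measurable f) (hg : Measurable g)
    (hf0 : ∀ x ∈ Ioi (0 : ℝ), 0 ≤ f x) (hg0 : ∀ y ∈ Ioi (0 : ℝ), 0 ≤ g y)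
    (hA0 : 0 < ∫⁻ x in Ioi (0 : ℝ), ENNReal.ofReal (x ^ (p * (1 - σ) - 1) * f x ^ p))
    (hA1 : (∫⁻ x in Ioi (0 : ℝ), ENNReal.ofReal (x ^ (p * (1 - σ) - 1) * f x ^ p)) < ⊤)
    (hB0 : 0 < ∫⁻ y in Ioi (0 : ℝ), ENNReal.ofReal (y ^ (q * (1 - σ) - 1) * g y ^ q))
    (hB1 : (∫⁻ y in Ioi (0 : ℝ), ENNReal.ofReal (y ^ (q * (1 - σ) - 1) * g y ^ q)) < ⊤) :
    (∫⁻ y in Ioi (0 : ℝ), ∫⁻ x in Ioi (0 : ℝ), ENNReal.ofReal (h (x * y) * f x * g y))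
      < (∫⁻ t in Ioi (0 : ℝ), ENNReal.ofReal (h t * t ^ (σ - 1))) *
          (∫⁻ x in Ioi (0 : ℝ), ENNReal.ofReal (x ^ (p * (1 - σ) - 1) * f x ^ p)) ^ (1 / p) *
          (∫⁻ y in Ioi (0 : ℝ), ENNReal.ofReal (y ^ (q * (1 - σ) - 1) * g y ^ q)) ^ (1 / q) := by
  have hconj : p.HolderConjugate q := Real.holderConjugate_iff.2 ⟨hp, by simpa using hpq⟩
  let H : ℝ → ENNReal := fun t ↦ ENNReal.ofReal (h t * t ^ σ)
  let P : ℝ → ENNReal := fun x ↦ ENNReal.ofReal (x ^ (1 - σ) * f x)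
  let Q : ℝ → ENNReal := fun y ↦ ENNReal.ofReal (y ^ (1 - σ) * g y)
  have hH : Measurable H := by fun_prop
  have hP : Measurable P := by fun_prop
  have hQ : Measurable Q := by fun_prop
  have hk : ∫⁻ t, H t ∂mulHaarIoi = ∫⁻ t in Ioi (0 : ℝ), ENNReal.ofReal (h t * t ^ (σ - 1)) := by
    rw [lintegral_mulHaarIoi hH]
    refine setLIntegral_congr_fun measurableSet_Ioi fun t (ht : 0 < t) ↦ ?_
    simp only [H]
    rw [← ENNReal.ofReal_mul (by positivity), Real.rpow_sub_one ht.ne']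
    ring_nf
  have hA : ∫⁻ x, P x ^ p ∂mulHaarIoi =
      ∫⁻ x in Ioi (0 : ℝ), ENNReal.ofReal (x ^ (p * (1 - σ) - 1) * f x ^ p) := by
    rw [lintegral_mulHaarIoi (by fun_prop)]
    exact setLIntegral_congr_fun measurableSet_Ioi fun x hx ↦
      ofReal_inv_mul_ofReal_rpow hconj.pos hx (hf0 x hx)
  have hB : ∫⁻ y, Q y ^ q ∂mulHaarIoi =
      ∫⁻ y in Ioi (0 : ℝ), ENNReal.ofReal (y ^ (q * (1 - σ) - 1) * g y ^ q) := by
    rw [lintegral_mulHaarIoi (by fun_prop)]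
    exact setLIntegral_congr_fun measurableSet_Ioi fun y hy ↦
      ofReal_inv_mul_ofReal_rpow hconj.symm.pos hy (hg0 y hy)
  have hL : ∫⁻ y, ∫⁻ x, H (x * y) * P x * Q y ∂mulHaarIoi ∂mulHaarIoi =
      ∫⁻ y in Ioi (0 : ℝ), ∫⁻ x in Ioi (0 : ℝ), ENNReal.ofReal (h (x * y) * f x * g y) := by
    have hinner : Measurable fun y ↦ ∫⁻ x, H (x * y) * P x * Q y ∂mulHaarIoi :=
      Measurable.lintegral_prod_right'
        (f := fun z : ℝ × ℝ ↦ H (z.2 * z.1) * P z.2 * Q z.1) (by fun_prop)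
    rw [lintegral_mulHaarIoi hinner]
    refine setLIntegral_congr_fun measurableSet_Ioi fun y (hy : 0 < y) ↦ ?_
    rw [lintegral_mulHaarIoi (by fun_prop), ← lintegral_const_mul _ (by fun_prop)]
    refine setLIntegral_congr_fun measurableSet_Ioi fun x (hx : 0 < x) ↦ ?_
    have hhxy := hh0 (x * y) (mul_pos hx hy)
    have hfx := hf0 x hx
    have hgy := hg0 y hy
    simp only [H, P, Q]
    rw [← ENNReal.ofReal_mul (by positivity), ← ENNReal.ofReal_mul (by positivity),
      ← ENNReal.ofReal_mul (by positivity), ← ENNReal.ofReal_mul (by positivity),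
      Real.mul_rpow hx.le hy.le, Real.rpow_sub hx, Real.rpow_sub hy, Real.rpow_one,
      Real.rpow_one]
    congr 1
    have := Real.rpow_pos_of_pos hx σ
    have := Real.rpow_pos_of_pos hy σ
    field_simp
  rw [← hk, ← hA, ← hB, ← hL]
  exact lintegral_kernel_mul_lt hconj hH hP hQ (hk ▸ hk0.ne') (hk ▸ hk1.ne) (hA ▸ hA0.ne')
    (hA ▸ hA1.ne) (hB ▸ hB0.ne') (hB ▸ hB1.ne)
end

section
/- Let p > 1 and let q satisfy 1/p + 1/q = 1, let σ ∈ ℝ, and let h be a nonnegative Lebesgue-measurable function on (0,∞) with k(σ) := ∫₀^∞ h(t) t^{σ-1} dt satisfying 0 < k(σ) < ∞. Let f be a nonnegative measurable function on (0,∞) such that 0 < ∫₀^∞ x^{p(1-σ)-1} f(x)^p dx < ∞. Then ∫₀^∞ y^{pσ-1} (∫₀^∞ h(x·y) f(x) dx)^p dy < k(σ)^p · ∫₀^∞ x^{p(1-σ)-1} f(x)^p dx. -/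
open MeasureTheory Set

theorem rpow_sub_one_mul_self {x : ENNReal} (h0 : x ≠ 0) (h1 : x ≠ ⊤) (p : ℝ) :
    x ^ (p - 1) * x = x ^ p := by
  nth_rewrite 2 [← ENNReal.rpow_one x]
  rw [← ENNReal.rpow_add _ _ h0 h1, sub_add_cancel]

/-- Strict Jensen inequality for `x ↦ x ^ p` on a finite measure space, in `lintegral` form. -/
theorem ae_eq_const_or_lintegral_rpow_lt {α : Type*} [MeasurableSpace α] {ν : Measure α}
    [IsFiniteMeasure ν] [NeZero ν] {p : ℝ} (hp : 1 < p) {ψ : α → ℝ} (hψ : Measurable ψ)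
    (hψ0 : ∀ x, 0 ≤ ψ x) (hfin : ∫⁻ x, ENNReal.ofReal (ψ x) ^ p ∂ν ≠ ⊤) :
    (∃ c, ∀ᵐ x ∂ν, ψ x = c) ∨
      (∫⁻ x, ENNReal.ofReal (ψ x) ∂ν) ^ p <
        ν univ ^ (p - 1) * ∫⁻ x, ENNReal.ofReal (ψ x) ^ p ∂ν := by
  have hp0 : 0 < p := by linarith
  have hpow : ∀ x, ENNReal.ofReal (ψ x) ^ p = ENNReal.ofReal (ψ x ^ p) := fun x =>
    ENNReal.ofReal_rpow_of_nonneg (hψ0 x) hp0.le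
  have hint : Integrable (fun x => ψ x ^ p) ν := by
    refine ⟨(hψ.pow_const p).aestronglyMeasurable, ?_⟩
    rw [hasFiniteIntegral_iff_ofReal (ae_of_all _ fun x => Real.rpow_nonneg (hψ0 x) p)]
    simp_rw [hpow] at hfin
    exact hfin.lt_top
  have hint1 : Integrable ψ ν := by
    have : MemLp ψ (ENNReal.ofReal p) ν := by
      rw [← integrable_norm_rpow_iff hψ.aestronglyMeasurable (by simpa using hp0)
        ENNReal.ofReal_ne_top, ENNReal.toReal_ofReal hp0.le]
      simpa only [Real.norm_of_nonneg (hψ0 _)] using hint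
    exact this.integrable (by simpa using hp.le)
  rcases (strictConvexOn_rpow hp).ae_eq_const_or_map_average_lt
    (continuousOn_id.rpow_const fun x _ => Or.inr hp0.le) isClosed_Ici
    (ae_of_all ν fun x => mem_Ici.2 (hψ0 x)) hint1 hint with hc | hlt
  · exact Or.inl ⟨_, hc⟩
  · right
    have hm : 0 < ν.real univ := measureReal_univ_pos
    have hI : 0 ≤ ∫ x, ψ x ∂ν := integral_nonneg hψ0
    have hP : 0 ≤ ∫ x, ψ x ^ p ∂ν := integral_nonneg fun x => Real.rpow_nonneg (hψ0 x) p
    simp_rw [hpow]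
    rw [← ofReal_integral_eq_lintegral_ofReal hint1 (ae_of_all _ hψ0),
      ← ofReal_integral_eq_lintegral_ofReal hint
        (ae_of_all _ fun x => Real.rpow_nonneg (hψ0 x) p),
      ← ofReal_measureReal (μ := ν) (s := univ), ENNReal.ofReal_rpow_of_nonneg hI hp0.le,
      ENNReal.ofReal_rpow_of_pos hm, ← ENNReal.ofReal_mul (by positivity)]
    rw [average_eq, average_eq, smul_eq_mul, smul_eq_mul,
      Real.mul_rpow (inv_nonneg.2 hm.le) hI, Real.inv_rpow hm.le] at hlt
    have hlt' : (∫ x, ψ x ∂ν) ^ p < ν.real univ ^ (p - 1) * ∫ x, ψ x ^ p ∂ν := by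
      have hmp : 0 < ν.real univ ^ p := Real.rpow_pos_of_pos hm p
      rw [inv_mul_lt_iff₀ hmp] at hlt
      rw [Real.rpow_sub_one hm.ne']
      calc _ < _ := hlt
        _ = _ := by ring
    exact (ENNReal.ofReal_lt_ofReal_iff (lt_of_le_of_lt (Real.rpow_nonneg hI p) hlt')).2 hlt'

/-- Jensen inequality for `x ↦ x ^ p` on a finite measure space, in `lintegral` form. -/
theorem lintegral_rpow_le_measure_univ_rpow_mul {α : Type*} [MeasurableSpace α] {ν : Measure α}
    [IsFiniteMeasure ν] [NeZero ν] {p : ℝ} (hp : 1 < p) {ψ : α → ℝ} (hψ : Measurable ψ)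
    (hψ0 : ∀ x, 0 ≤ ψ x) :
    (∫⁻ x, ENNReal.ofReal (ψ x) ∂ν) ^ p ≤
      ν univ ^ (p - 1) * ∫⁻ x, ENNReal.ofReal (ψ x) ^ p ∂ν := by
  have hK0 : ν univ ≠ 0 := by simpa using NeZero.ne ν
  have hK1 : ν univ ≠ ⊤ := measure_ne_top ν univ
  by_cases hfin : ∫⁻ x, ENNReal.ofReal (ψ x) ^ p ∂ν = ⊤
  · rw [hfin, ENNReal.mul_top (ENNReal.rpow_pos (pos_iff_ne_zero.2 hK0) hK1).ne']
    exact le_top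
  rcases ae_eq_const_or_lintegral_rpow_lt hp hψ hψ0 hfin with ⟨c, hc⟩ | hlt
  · have e1 : ∫⁻ x, ENNReal.ofReal (ψ x) ∂ν = ENNReal.ofReal c * ν univ := by
      rw [← lintegral_const]
      exact lintegral_congr_ae (hc.mono fun x hx => by simp [hx])
    have e2 : ∫⁻ x, ENNReal.ofReal (ψ x) ^ p ∂ν = ENNReal.ofReal c ^ p * ν univ := by
      rw [← lintegral_const]
      exact lintegral_congr_ae (hc.mono fun x hx => by simp [hx])
    rw [e1, e2, ENNReal.mul_rpow_of_nonneg _ _ (by linarith : 0 ≤ p), mul_left_comm,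
      rpow_sub_one_mul_self hK0 hK1]
  · exact hlt.le

/-- An almost everywhere periodic function with finite integral has zero integral. -/
theorem lintegral_eq_zero_of_ae_periodic {g : ℝ → ENNReal} {d : ℝ}
    (hd : d ≠ 0) (hper : ∀ᵐ v, g (v + d) = g v) (hfin : ∫⁻ v, g v ≠ ⊤) : ∫⁻ v, g v = 0 := by
  have key : ∀ a, ∫⁻ v in Iic (a + d), g v = ∫⁻ v in Iic a, g v := by
    intro a
    rw [← lintegral_indicator measurableSet_Iic, ← lintegral_indicator measurableSet_Iic,
      ← lintegral_add_right_eq_self _ d]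
    refine lintegral_congr_ae (hper.mono fun v hv => ?_)
    by_cases hva : v ≤ a <;> simp [indicator, hva, hv]
  have key' : ∀ a, ∫⁻ v in Iic (a + |d|), g v = ∫⁻ v in Iic a, g v := by
    intro a
    rcases abs_choice d with h | h <;> rw [h]
    · exact key a
    · simpa using (key (a + -d)).symm
  have keyn : ∀ (n : ℕ) a, ∫⁻ v in Iic (a + n * |d|), g v = ∫⁻ v in Iic a, g v := by
    intro n
    induction n with
    | zero => simp
    | succ n ih =>
      intro a
      rw [← ih a, ← key' (a + n * |d|)]
      push_cast
      ring_nf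
  set μ : Measure ℝ := volume.withDensity g
  have hμ : ∀ a, μ (Iic a) = ∫⁻ v in Iic a, g v := fun a =>
    withDensity_apply _ measurableSet_Iic
  have hμu : μ univ = ∫⁻ v, g v := by simp [μ]
  have hle : ∀ a, μ univ ≤ μ (Iic a) := by
    intro a
    refine le_of_tendsto (tendsto_measure_Iic_atTop μ) (Filter.Eventually.of_forall fun b => ?_)
    obtain ⟨n, hn⟩ := exists_nat_ge ((b - a) / |d|)
    rw [div_le_iff₀ (abs_pos.2 hd)] at hn
    rw [hμ a, ← keyn n a, ← hμ]
    exact measure_mono (Iic_subset_Iic.2 (by linarith))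
  have hIoi : ∀ a, μ (Ioi a) = 0 := by
    intro a
    have hne : μ (Iic a) ≠ ⊤ := ((measure_mono (subset_univ _)).trans_lt
      (hμu ▸ hfin.lt_top)).ne
    rw [← compl_Iic, measure_compl measurableSet_Iic hne]
    exact tsub_eq_zero_of_le (hle a)
  rw [← hμu]
  refine le_antisymm (le_of_tendsto (tendsto_measure_Ici_atBot μ)
    (Filter.Eventually.of_forall fun b => ?_)) zero_le
  rw [← hIoi (b - 1)]
  exact measure_mono (Ici_subset_Ioi.2 (by linarith))

/-- If almost every translate of `φ` is `ν`-a.e. constant and `ν` has no atoms, then `φ` has a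
nonzero period almost everywhere. -/
theorem exists_ae_eq_comp_add_of_ae_const {ν : Measure ℝ} [SFinite ν] [NeZero ν] [NullSingletonClass ν]
    {φ : ℝ → ℝ} (hφ : Measurable φ) (hc : ∀ᵐ v : ℝ, ∃ c, ∀ᵐ w ∂ν, φ (w - v) = c) :
    ∃ d ≠ 0, ∀ᵐ v : ℝ, φ (v + d) = φ v := by
  have h1 : ∀ᵐ v : ℝ, ∀ᵐ z ∂ν.prod ν, φ (z.1 - v) = φ (z.2 - v) := by
    filter_upwards [hc] with v ⟨c, hv⟩
    filter_upwards [Measure.quasiMeasurePreserving_fst.ae hv,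
      Measure.quasiMeasurePreserving_snd.ae hv] with z hz1 hz2
    rw [hz1, hz2]
  rw [Measure.ae_ae_comm (p := fun (v : ℝ) (z : ℝ × ℝ) => φ (z.1 - v) = φ (z.2 - v))
    (measurableSet_eq_fun (by fun_prop) (by fun_prop))] at h1
  obtain ⟨w, hw⟩ := (Measure.ae_ae_of_ae_prod h1).exists
  obtain ⟨w', hw', hne⟩ := (hw.and (Measure.ae_ne ν w)).exists
  refine ⟨w' - w, sub_ne_zero.2 hne, ?_⟩
  have := (Measure.measurePreserving_sub_left volume w).quasiMeasurePreserving.ae hw'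
  filter_upwards [this] with v hv
  simp only [sub_sub_cancel] at hv
  rw [hv]
  congr 1
  ring

/-- Strict Young inequality for the correlation of an `L^p` function with an atomless measure. -/
theorem lintegral_rpow_lintegral_sub_lt {ν : Measure ℝ} [IsFiniteMeasure ν] [NeZero ν] [NullSingletonClass ν]
    {p : ℝ} (hp : 1 < p) {φ : ℝ → ℝ} (hφ : Measurable φ) (hφ0 : ∀ x, 0 ≤ φ x)
    (h0 : ∫⁻ s, ENNReal.ofReal (φ s) ^ p ≠ 0) (h1 : ∫⁻ s, ENNReal.ofReal (φ s) ^ p ≠ ⊤) :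
    ∫⁻ v, (∫⁻ w, ENNReal.ofReal (φ (w - v)) ∂ν) ^ p <
      ν univ ^ p * ∫⁻ s, ENNReal.ofReal (φ s) ^ p := by
  have hK0 : ν univ ≠ 0 := by simpa using NeZero.ne ν
  have hK1 : ν univ ≠ ⊤ := measure_ne_top ν univ
  set A := ∫⁻ s, ENNReal.ofReal (φ s) ^ p
  set R : ℝ → ENNReal := fun v => ν univ ^ (p - 1) * ∫⁻ w, ENNReal.ofReal (φ (w - v)) ^ p ∂ν
  have hm : Measurable (fun v => ∫⁻ w, ENNReal.ofReal (φ (w - v)) ^ p ∂ν) :=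
    Measurable.lintegral_prod_right' (f := fun z : ℝ × ℝ => ENNReal.ofReal (φ (z.2 - z.1)) ^ p)
      (by fun_prop)
  have hswap : ∫⁻ v, ∫⁻ w, ENNReal.ofReal (φ (w - v)) ^ p ∂ν = A * ν univ := by
    rw [lintegral_lintegral_swap (by fun_prop)]
    simp_rw [fun w => lintegral_sub_left_eq_self (μ := volume)
      (fun s => ENNReal.ofReal (φ s) ^ p) w]
    exact lintegral_const A
  have hR : ∫⁻ v, R v = ν univ ^ p * A := by
    rw [lintegral_const_mul _ hm, hswap, mul_left_comm,
      rpow_sub_one_mul_self hK0 hK1, mul_comm]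
  have hJR : ∀ v, (∫⁻ w, ENNReal.ofReal (φ (w - v)) ∂ν) ^ p ≤ R v := fun v =>
    lintegral_rpow_le_measure_univ_rpow_mul hp (by fun_prop) fun _ => hφ0 _
  rw [← hR]
  refine lt_of_le_of_ne (lintegral_mono hJR) fun heq => ?_
  have hRfin : ∫⁻ v, R v ≠ ⊤ := by
    rw [hR]
    exact ENNReal.mul_ne_top (ENNReal.rpow_ne_top_of_nonneg (by linarith) hK1) h1
  have hae := ae_eq_of_ae_le_of_lintegral_le (ae_of_all _ hJR) (heq ▸ hRfin)
    (hm.const_mul _).aemeasurable heq.ge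
  have hfin : ∀ᵐ v : ℝ, ∫⁻ w, ENNReal.ofReal (φ (w - v)) ^ p ∂ν < ⊤ :=
    ae_lt_top hm (by rw [hswap]; exact ENNReal.mul_ne_top h1 hK1)
  have hconst : ∀ᵐ v : ℝ, ∃ c, ∀ᵐ w ∂ν, φ (w - v) = c := by
    filter_upwards [hae, hfin] with v hv hvf
    exact (ae_eq_const_or_lintegral_rpow_lt hp (by fun_prop) (fun _ => hφ0 _)
      hvf.ne).resolve_right hv.not_lt
  obtain ⟨d, hd, hper⟩ := exists_ae_eq_comp_add_of_ae_const hφ hconst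
  exact h0 (lintegral_eq_zero_of_ae_periodic hd (hper.mono fun v hv => by rw [hv]) h1)

theorem lintegral_Ioi_eq_lintegral_exp (g : ℝ → ENNReal) :
    ∫⁻ x in Ioi 0, g x = ∫⁻ s, ENNReal.ofReal (Real.exp s) * g (Real.exp s) := by
  have := lintegral_image_eq_lintegral_abs_deriv_mul MeasurableSet.univ
    (fun x _ => (Real.hasDerivAt_exp x).hasDerivWithinAt) Real.exp_injective.injOn g
  simpa [image_univ, Real.range_exp] using this

/-- Equivalent strict form of the Yang–Hilbert inequality:
`∫₀^∞ y^{pσ-1} (∫₀^∞ h(xy) f(x) dx)^p dy < k(σ)^p ∫₀^∞ x^{p(1-σ)-1} f(x)^p dx`. -/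
theorem stmt3 (p q σ : ℝ) (hp : 1 < p) (hpq : 1 / p + 1 / q = 1)
    (h : ℝ → ℝ) (hh : Measurable h) (hh0 : ∀ t ∈ Ioi (0 : ℝ), 0 ≤ h t)
    (hk0 : 0 < ∫⁻ t in Ioi (0 : ℝ), ENNReal.ofReal (h t * t ^ (σ - 1)))
    (hk1 : (∫⁻ t in Ioi (0 : ℝ), ENNReal.ofReal (h t * t ^ (σ - 1))) < ⊤)
    (f : ℝ → ℝ) (hf : Measurable f) (hf0 : ∀ x ∈ Ioi (0 : ℝ), 0 ≤ f x)
    (hA0 : 0 < ∫⁻ x in Ioi (0 : ℝ), ENNReal.ofReal (x ^ (p * (1 - σ) - 1) * f x ^ p))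
    (hA1 : (∫⁻ x in Ioi (0 : ℝ), ENNReal.ofReal (x ^ (p * (1 - σ) - 1) * f x ^ p)) < ⊤) :
    (∫⁻ y in Ioi (0 : ℝ),
        ENNReal.ofReal (y ^ (p * σ - 1)) *
          (∫⁻ x in Ioi (0 : ℝ), ENNReal.ofReal (h (x * y) * f x)) ^ p)
      < (∫⁻ t in Ioi (0 : ℝ), ENNReal.ofReal (h t * t ^ (σ - 1))) ^ p *
          ∫⁻ x in Ioi (0 : ℝ), ENNReal.ofReal (x ^ (p * (1 - σ) - 1) * f x ^ p) := by
  have hp0 : 0 < p := by linarith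
  set κ : ℝ → ENNReal := fun w => ENNReal.ofReal (Real.exp (σ * w) * h (Real.exp w)) with hκ
  have hκm : Measurable κ := by fun_prop
  set φ : ℝ → ℝ := fun s => Real.exp ((1 - σ) * s) * f (Real.exp s) with hφdef
  have hφm : Measurable φ := by fun_prop
  have hφ0 : ∀ s, 0 ≤ φ s := fun s =>
    mul_nonneg (Real.exp_pos _).le (hf0 _ (Real.exp_pos s))
  have hk : ∫⁻ t in Ioi (0 : ℝ), ENNReal.ofReal (h t * t ^ (σ - 1)) = ∫⁻ w, κ w := by
    rw [lintegral_Ioi_eq_lintegral_exp]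
    refine lintegral_congr fun w => ?_
    rw [← ENNReal.ofReal_mul (Real.exp_pos w).le, ← Real.exp_mul, mul_left_comm, ← Real.exp_add,
      mul_comm, show w + w * (σ - 1) = σ * w by ring]
  have hA : ∫⁻ x in Ioi (0 : ℝ), ENNReal.ofReal (x ^ (p * (1 - σ) - 1) * f x ^ p) =
      ∫⁻ s, ENNReal.ofReal (φ s) ^ p := by
    rw [lintegral_Ioi_eq_lintegral_exp]
    refine lintegral_congr fun s => ?_
    rw [ENNReal.ofReal_rpow_of_nonneg (hφ0 s) hp0.le, ← ENNReal.ofReal_mul (Real.exp_pos s).le,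
      Real.mul_rpow (Real.exp_pos _).le (hf0 _ (Real.exp_pos s)), ← Real.exp_mul, ← Real.exp_mul,
      ← mul_assoc, ← Real.exp_add]
    ring_nf
  have hinner : ∀ v, ∫⁻ x in Ioi (0 : ℝ), ENNReal.ofReal (h (x * Real.exp v) * f x) =
      ENNReal.ofReal (Real.exp (-σ * v)) *
        ∫⁻ w, ENNReal.ofReal (φ (w - v)) ∂(volume.withDensity κ) := by
    intro v
    rw [lintegral_withDensity_eq_lintegral_mul _ hκm (by fun_prop),
      ← lintegral_const_mul _ (by fun_prop), lintegral_Ioi_eq_lintegral_exp,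
      ← lintegral_sub_right_eq_self _ v]
    refine lintegral_congr fun w => ?_
    have hhw := hh0 _ (Real.exp_pos w)
    simp only [Pi.mul_apply, hκ, hφdef]
    rw [← ENNReal.ofReal_mul (Real.exp_pos _).le, ← ENNReal.ofReal_mul (by positivity),
      ← ENNReal.ofReal_mul (Real.exp_pos _).le, ← Real.exp_add, sub_add_cancel]
    congr 1
    have : Real.exp (w - v) =
        Real.exp (-σ * v) * Real.exp (σ * w) * Real.exp ((1 - σ) * (w - v)) := by
      rw [← Real.exp_add, ← Real.exp_add]
      ring_nf
    calc Real.exp (w - v) * (h (Real.exp w) * f (Real.exp (w - v)))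
        = (Real.exp (-σ * v) * Real.exp (σ * w) * Real.exp ((1 - σ) * (w - v))) *
          (h (Real.exp w) * f (Real.exp (w - v))) := by rw [← this]
      _ = _ := by ring
  have houter : (∫⁻ y in Ioi (0 : ℝ), ENNReal.ofReal (y ^ (p * σ - 1)) *
        (∫⁻ x in Ioi (0 : ℝ), ENNReal.ofReal (h (x * y) * f x)) ^ p) =
      ∫⁻ v, (∫⁻ w, ENNReal.ofReal (φ (w - v)) ∂(volume.withDensity κ)) ^ p := by
    rw [lintegral_Ioi_eq_lintegral_exp]
    refine lintegral_congr fun v => ?_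
    rw [hinner, ENNReal.mul_rpow_of_nonneg _ _ hp0.le,
      ENNReal.ofReal_rpow_of_pos (Real.exp_pos _), ← mul_assoc, ← mul_assoc,
      ← ENNReal.ofReal_mul (Real.exp_pos _).le, ← ENNReal.ofReal_mul (by positivity),
      ← Real.exp_mul, ← Real.exp_mul, ← Real.exp_add, ← Real.exp_add]
    have : v + v * (p * σ - 1) + -σ * v * p = 0 := by ring
    rw [this, Real.exp_zero, ENNReal.ofReal_one, one_mul]
  have huniv : volume.withDensity κ univ = ∫⁻ w, κ w := by simp
  rw [hk] at hk0 hk1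
  rw [hA] at hA0 hA1
  rw [houter, hk, hA, ← huniv]
  have : IsFiniteMeasure (volume.withDensity κ) := ⟨huniv ▸ hk1⟩
  have : NeZero (volume.withDensity κ) :=
    ⟨fun h0 => hk0.ne' (by rw [← huniv, h0, Measure.coe_zero, Pi.zero_apply])⟩
  exact lintegral_rpow_lintegral_sub_lt hp hφm hφ0 hA0.ne' hA1.ne
end

section
/- Let p > 1 and let q satisfy 1/p + 1/q = 1, let μ, σ ∈ ℝ with μ + σ = λ, and let k_λ be a nonnegative measurable function on (0,∞)×(0,∞) that is homogeneous of degree −λ, with k_λ(σ) := ∫₀^∞ k_λ(1,t) t^{σ-1} dt satisfying 0 < k_λ(σ) < ∞. Let f, g be nonnegative measurable functions on (0,∞) such that 0 < ∫₀^∞ x^{p(1−μ)−1} f(x)^p dx < ∞ and 0 < ∫₀^∞ y^{q(1−σ)−1} g(y)^q dy < ∞. Then ∫₀^∞ ∫₀^∞ k_λ(x,y) f(x) g(y) dx dy < k_λ(σ) · (∫₀^∞ x^{p(1−μ)−1} f(x)^p dx)^{1/p} · (∫₀^∞ y^{q(1−σ)−1} g(y)^q dy)^{1/q}. -/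
open MeasureTheory Set

/-- Linear substitution on a half-line of positive reals. -/
lemma lintegral_Ioi_mul_left {a : ℝ} (ha : 0 < a) (c : ℝ) (h : ℝ → ENNReal) :
    ∫⁻ y in Ioi (a * c), h y = ∫⁻ x in Ioi c, ENNReal.ofReal a * h (a * x) := by
  have himage : (fun x => a * x) '' Ioi c = Ioi (a * c) := image_mul_left_Ioi ha c
  have hderiv : ∀ x ∈ Ioi c, HasDerivWithinAt (fun x => a * x) a (Ioi c) x := fun x _ => by
    simpa using ((hasDerivAt_id x).const_mul a).hasDerivWithinAt
  have := lintegral_image_eq_lintegral_abs_deriv_mul measurableSet_Ioi hderiv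
    (mul_right_injective₀ ha.ne').injOn h
  rw [himage, abs_of_pos ha] at this
  exact this

/-- Dilation invariance of `dx / x` on the positive half-line. -/
lemma lintegral_Ioi_mul_left_mul_inv {a c : ℝ} (ha : 0 < a) (hc : 0 ≤ c) (h : ℝ → ℝ) :
    ∫⁻ y in Ioi (a * c), ENNReal.ofReal (h y * y⁻¹)
      = ∫⁻ x in Ioi c, ENNReal.ofReal (h (a * x) * x⁻¹) := by
  rw [lintegral_Ioi_mul_left ha]
  refine setLIntegral_congr_fun measurableSet_Ioi fun x hx => ?_
  have hx0 : 0 < x := hc.trans_lt hx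
  rw [← ENNReal.ofReal_mul ha.le]
  congr 1
  field_simp

/-- A function invariant under a nontrivial dilation is integrable against `dx / x` only if its
integral vanishes. -/
lemma lintegral_mul_inv_eq_zero_of_dilation_invariant {s : ℝ} (hs : 1 < s) {h : ℝ → ℝ}
    (hinv : ∀ᵐ x ∂volume.restrict (Ioi (0 : ℝ)), h (s * x) = h x)
    (hfin : ∫⁻ x in Ioi (0 : ℝ), ENNReal.ofReal (h x * x⁻¹) ≠ ⊤) :
    ∫⁻ x in Ioi (0 : ℝ), ENNReal.ofReal (h x * x⁻¹) = 0 := by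
  have hs0 : 0 < s := one_pos.trans hs
  set m := volume.withDensity fun x => ENNReal.ofReal (h x * x⁻¹) with hm
  have hmI (c : ℝ) : m (Ioi c) = ∫⁻ x in Ioi c, ENNReal.ofReal (h x * x⁻¹) :=
    withDensity_apply _ measurableSet_Ioi
  have hstep {c : ℝ} (hc : 0 < c) : m (Ioi (s * c)) = m (Ioi c) := by
    rw [hmI, hmI, lintegral_Ioi_mul_left_mul_inv hs0 hc.le]
    refine lintegral_congr_ae ?_
    filter_upwards [ae_restrict_of_ae_restrict_of_subset (Ioi_subset_Ioi hc.le) hinv] with x hx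
    rw [hx]
  have hpow {c : ℝ} (hc : 0 < c) (n : ℕ) : m (Ioi (s ^ n * c)) = m (Ioi c) := by
    induction n with
    | zero => simp
    | succ n ih => rw [pow_succ', mul_assoc, hstep (by positivity), ih]
  have hzero {c : ℝ} (hc : 0 < c) : m (Ioi c) = 0 := by
    have htend := tendsto_measure_iInter_atTop (μ := m) (s := fun n : ℕ => Ioi (s ^ n * c))
      (fun n => measurableSet_Ioi.nullMeasurableSet)
      (fun i j hij => Ioi_subset_Ioi
        (mul_le_mul_of_nonneg_right (pow_le_pow_right₀ hs.le hij) hc.le))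
      ⟨0, by
        rw [hpow hc]
        refine ne_top_of_le_ne_top hfin ?_
        rw [← hmI]
        exact measure_mono (Ioi_subset_Ioi hc.le)⟩
    have hempty : ⋂ n : ℕ, Ioi (s ^ n * c) = ∅ := by
      refine eq_empty_of_forall_notMem fun x hx => ?_
      obtain ⟨n, hn⟩ := pow_unbounded_of_one_lt (x / c) hs
      have hxn : s ^ n * c < x := mem_iInter.1 hx n
      rw [div_lt_iff₀ hc] at hn
      exact lt_asymm hn hxn
    rw [hempty, measure_empty] at htend
    exact tendsto_nhds_unique (tendsto_const_nhds.congr fun n => (hpow hc n).symm) htend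
  rw [← hmI]
  have hunion : Ioi (0 : ℝ) = ⋃ n : ℕ, Ioi (1 / ((n : ℝ) + 1)) := by
    ext x
    simp only [mem_Ioi, mem_iUnion]
    exact ⟨fun hx => exists_nat_one_div_lt hx, fun ⟨n, hn⟩ => lt_trans (by positivity) hn⟩
  rw [hunion, measure_iUnion_null_iff]
  exact fun n => hzero (by positivity)

section Normalized

variable {r s : ℝ} {w z : ℝ → ℝ}

/-- Hölder's inequality for `dx / x` and normalized functions, with the equality case. -/
lemma lintegral_rpow_mul_rpow_le_one (hr : 0 < r) (hs : 0 < s) (hrs : r + s = 1)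
    (hw : Measurable w) (hz : Measurable z)
    (hw0 : ∀ x ∈ Ioi (0 : ℝ), 0 ≤ w x) (hz0 : ∀ x ∈ Ioi (0 : ℝ), 0 ≤ z x)
    (hw1 : ∫⁻ x in Ioi (0 : ℝ), ENNReal.ofReal (w x * x⁻¹) = 1)
    (hz1 : ∫⁻ x in Ioi (0 : ℝ), ENNReal.ofReal (z x * x⁻¹) = 1) :
    ∫⁻ x in Ioi (0 : ℝ), ENNReal.ofReal (w x ^ r * z x ^ s * x⁻¹) ≤ 1 ∧
      (∫⁻ x in Ioi (0 : ℝ), ENNReal.ofReal (w x ^ r * z x ^ s * x⁻¹) = 1 →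
        ∀ᵐ x ∂volume.restrict (Ioi (0 : ℝ)), w x = z x) := by
  have hmean : ∫⁻ x in Ioi (0 : ℝ), ENNReal.ofReal ((r * w x + s * z x) * x⁻¹) = 1 := by
    calc ∫⁻ x in Ioi (0 : ℝ), ENNReal.ofReal ((r * w x + s * z x) * x⁻¹)
        = ∫⁻ x in Ioi (0 : ℝ), (ENNReal.ofReal r * ENNReal.ofReal (w x * x⁻¹)
            + ENNReal.ofReal s * ENNReal.ofReal (z x * x⁻¹)) := by
          refine setLIntegral_congr_fun measurableSet_Ioi fun x hx => ?_
          have hx0 : (0 : ℝ) < x := hx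
          have := hw0 x hx
          have := hz0 x hx
          rw [← ENNReal.ofReal_mul hr.le, ← ENNReal.ofReal_mul hs.le,
            ← ENNReal.ofReal_add (by positivity) (by positivity)]
          congr 1
          ring
      _ = 1 := by
          rw [lintegral_add_left (by fun_prop), lintegral_const_mul _ (by fun_prop),
            lintegral_const_mul _ (by fun_prop), hw1, hz1, mul_one, mul_one,
            ← ENNReal.ofReal_add hr.le hs.le, hrs, ENNReal.ofReal_one]
  have hle : ∀ᵐ x ∂volume.restrict (Ioi (0 : ℝ)), ENNReal.ofReal (w x ^ r * z x ^ s * x⁻¹)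
      ≤ ENNReal.ofReal ((r * w x + s * z x) * x⁻¹) := by
    refine ae_restrict_of_forall_mem measurableSet_Ioi fun x hx => ?_
    exact ENNReal.ofReal_le_ofReal (mul_le_mul_of_nonneg_right
      (Real.geom_mean_le_arith_mean2_weighted hr.le hs.le (hw0 x hx) (hz0 x hx) hrs)
      (inv_nonneg.2 (le_of_lt hx)))
  refine ⟨hmean ▸ lintegral_mono_ae hle, fun heq => ?_⟩
  have hae := ae_eq_of_ae_le_of_lintegral_le hle (by simp [heq]) (by fun_prop)
    (by rw [hmean, heq])
  filter_upwards [hae, ae_restrict_mem measurableSet_Ioi] with x hx hx0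
  have hxpos : (0 : ℝ) < x := hx0
  have := hw0 x hx0
  have := hz0 x hx0
  rw [ENNReal.ofReal_eq_ofReal_iff (by positivity) (by positivity)] at hx
  exact (Real.geom_mean_eq_arith_mean2_weighted_iff_of_pos hr hs (hw0 x hx0) (hz0 x hx0) hrs).1
    (mul_right_cancel₀ (inv_ne_zero hxpos.ne') hx)

/-- The multiplicative correlation of two normalized functions attains `1` at most once. -/
lemma exists_forall_ne_lintegral_rpow_mul_rpow_lt_one (hr : 0 < r) (hs : 0 < s) (hrs : r + s = 1)
    (hw : Measurable w) (hz : Measurable z)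
    (hw0 : ∀ x ∈ Ioi (0 : ℝ), 0 ≤ w x) (hz0 : ∀ x ∈ Ioi (0 : ℝ), 0 ≤ z x)
    (hw1 : ∫⁻ x in Ioi (0 : ℝ), ENNReal.ofReal (w x * x⁻¹) = 1)
    (hz1 : ∫⁻ x in Ioi (0 : ℝ), ENNReal.ofReal (z x * x⁻¹) = 1) :
    (∀ t ∈ Ioi (0 : ℝ),
      ∫⁻ x in Ioi (0 : ℝ), ENNReal.ofReal (w x ^ r * z (t * x) ^ s * x⁻¹) ≤ 1) ∧
    ∃ t₀ : ℝ, ∀ t ∈ Ioi (0 : ℝ), t ≠ t₀ →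
      ∫⁻ x in Ioi (0 : ℝ), ENNReal.ofReal (w x ^ r * z (t * x) ^ s * x⁻¹) < 1 := by
  have hzt {t : ℝ} (ht : 0 < t) :
      ∫⁻ x in Ioi (0 : ℝ), ENNReal.ofReal (z (t * x) * x⁻¹) = 1 := by
    rw [← lintegral_Ioi_mul_left_mul_inv ht le_rfl, mul_zero, hz1]
  have hyoung {t : ℝ} (ht : 0 < t) := lintegral_rpow_mul_rpow_le_one hr hs hrs hw
    (hz.comp (measurable_const_mul t)) hw0 (fun x hx => hz0 _ (mul_pos ht hx)) hw1 (hzt ht)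
  simp only [Function.comp_apply] at hyoung
  refine ⟨fun t ht => (hyoung ht).1, ?_⟩
  have huniq {t₁ t₂ : ℝ} (h₁ : 0 < t₁) (h₂ : t₁ < t₂)
      (e₁ : ∀ᵐ x ∂volume.restrict (Ioi (0 : ℝ)), w x = z (t₁ * x))
      (e₂ : ∀ᵐ x ∂volume.restrict (Ioi (0 : ℝ)), w x = z (t₂ * x)) : False := by
    have hinv : ∀ᵐ x ∂volume.restrict (Ioi (0 : ℝ)), z (t₁ * (t₂ / t₁ * x)) = z (t₁ * x) := by
      filter_upwards [e₁, e₂] with x hx₁ hx₂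
      rw [← mul_assoc, mul_div_cancel₀ _ h₁.ne', ← hx₁, hx₂]
    have := lintegral_mul_inv_eq_zero_of_dilation_invariant (h := fun x => z (t₁ * x))
      ((one_lt_div h₁).2 h₂) hinv (by simp [hzt h₁])
    simp [hzt h₁] at this
  by_contra! hcon
  obtain ⟨t₁, h₁, -, e₁⟩ := hcon 0
  obtain ⟨t₂, h₂, hne, e₂⟩ := hcon t₁
  have a₁ := (hyoung h₁).2 ((hyoung h₁).1.antisymm e₁)
  have a₂ := (hyoung h₂).2 ((hyoung h₂).1.antisymm e₂)
  rcases lt_or_gt_of_ne hne with h | h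
  · exact huniq h₂ h a₂ a₁
  · exact huniq h₁ h a₁ a₂

/-- Averaging the multiplicative correlation of two normalized functions against a nonzero
integrable weight strictly decreases the mass of the weight. -/
lemma lintegral_mul_lintegral_rpow_mul_rpow_lt (hr : 0 < r) (hs : 0 < s) (hrs : r + s = 1)
    (hw : Measurable w) (hz : Measurable z)
    (hw0 : ∀ x ∈ Ioi (0 : ℝ), 0 ≤ w x) (hz0 : ∀ x ∈ Ioi (0 : ℝ), 0 ≤ z x)
    (hw1 : ∫⁻ x in Ioi (0 : ℝ), ENNReal.ofReal (w x * x⁻¹) = 1)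
    (hz1 : ∫⁻ x in Ioi (0 : ℝ), ENNReal.ofReal (z x * x⁻¹) = 1)
    {K : ℝ → ℝ} (hK : Measurable K)
    (hK0 : ∫⁻ t in Ioi (0 : ℝ), ENNReal.ofReal (K t) ≠ 0)
    (hK1 : ∫⁻ t in Ioi (0 : ℝ), ENNReal.ofReal (K t) ≠ ⊤) :
    ∫⁻ t in Ioi (0 : ℝ), ENNReal.ofReal (K t) *
        ∫⁻ x in Ioi (0 : ℝ), ENNReal.ofReal (w x ^ r * z (t * x) ^ s * x⁻¹)
      < ∫⁻ t in Ioi (0 : ℝ), ENNReal.ofReal (K t) := by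
  obtain ⟨hle, t₀, hlt⟩ :=
    exists_forall_ne_lintegral_rpow_mul_rpow_lt_one hr hs hrs hw hz hw0 hz0 hw1 hz1
  have hmono : ∀ᵐ t ∂volume.restrict (Ioi (0 : ℝ)), ENNReal.ofReal (K t) *
      ∫⁻ x in Ioi (0 : ℝ), ENNReal.ofReal (w x ^ r * z (t * x) ^ s * x⁻¹)
        ≤ ENNReal.ofReal (K t) :=
    ae_restrict_of_forall_mem measurableSet_Ioi fun t ht => mul_le_of_le_one_right' (hle t ht)
  refine lintegral_strict_mono_of_ae_le_of_frequently_ae_lt (by fun_prop)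
    (ne_top_of_le_ne_top hK1 (lintegral_mono_ae hmono)) hmono fun hcon => hK0 ?_
  rw [lintegral_eq_zero_iff (by fun_prop)]
  have hne : ∀ᵐ t ∂volume.restrict (Ioi (0 : ℝ)), t ≠ t₀ :=
    ae_restrict_of_ae (Measure.ae_ne volume t₀)
  filter_upwards [hcon, hne, ae_restrict_mem measurableSet_Ioi] with t ht htne ht0
  by_contra hKt
  refine ht (ne_of_lt ?_)
  calc _ < ENNReal.ofReal (K t) * 1 :=
        (ENNReal.mul_lt_mul_iff_right hKt ENNReal.ofReal_ne_top).2 (hlt t ht0 htne)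
    _ = _ := mul_one _

end Normalized

/-- Dividing by the mass normalizes a weighted `p`-th power with respect to `dx / x`. -/
lemma lintegral_rpow_mul_rpow_div_mul_inv_eq_one {c p : ℝ} {f : ℝ → ℝ}
    (h0 : 0 < ∫⁻ x in Ioi (0 : ℝ), ENNReal.ofReal (x ^ (c - 1) * f x ^ p))
    (h1 : ∫⁻ x in Ioi (0 : ℝ), ENNReal.ofReal (x ^ (c - 1) * f x ^ p) < ⊤) :
    ∫⁻ x in Ioi (0 : ℝ), ENNReal.ofReal (x ^ c * f x ^ p /
      (∫⁻ x in Ioi (0 : ℝ), ENNReal.ofReal (x ^ (c - 1) * f x ^ p)).toReal * x⁻¹) = 1 := by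
  set A := ∫⁻ x in Ioi (0 : ℝ), ENNReal.ofReal (x ^ (c - 1) * f x ^ p) with hA
  have hApos : 0 < A.toReal := ENNReal.toReal_pos h0.ne' h1.ne
  calc _ = ∫⁻ x in Ioi (0 : ℝ), ENNReal.ofReal (x ^ (c - 1) * f x ^ p) *
        ENNReal.ofReal A.toReal⁻¹ := by
        refine setLIntegral_congr_fun measurableSet_Ioi fun x hx => ?_
        have hx0 : (0 : ℝ) < x := hx
        rw [← ENNReal.ofReal_mul' (by positivity), Real.rpow_sub_one hx0.ne']
        congr 1
        field_simp
    _ = 1 := by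
        rw [lintegral_mul_const' _ _ ENNReal.ofReal_ne_top, ENNReal.ofReal_inv_of_pos hApos,
          ENNReal.ofReal_toReal h1.ne]
        exact ENNReal.mul_inv_cancel h0.ne' h1.ne

/-- The root of a weighted power, normalized by its mass. -/
lemma rpow_mul_rpow_div_rpow_one_div {x y A a p : ℝ} (hp : p ≠ 0) (hx : 0 < x) (hy : 0 ≤ y)
    (hA : 0 < A) :
    (x ^ (p * a) * y ^ p / A) ^ (1 / p) = x ^ a * y / A ^ (1 / p) := by
  rw [Real.div_rpow (by positivity) hA.le, Real.mul_rpow (by positivity) (by positivity),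
    ← Real.rpow_mul hx.le, ← Real.rpow_mul hy]
  congr 3
  · field_simp
  · rw [mul_one_div_cancel hp, Real.rpow_one]

open MeasureTheory Set

/-- Yang–Hilbert-type inequality with a homogeneous kernel of degree `-λ`:
`∫₀^∞∫₀^∞ k_λ(x,y) f(x) g(y) dx dy
  < k_λ(σ) (∫₀^∞ x^{p(1-μ)-1} f^p)^{1/p} (∫₀^∞ y^{q(1-σ)-1} g^q)^{1/q}`. -/
theorem stmt9 (p q lam mu σ : ℝ) (hp : 1 < p) (hpq : 1 / p + 1 / q = 1)
    (hms : mu + σ = lam)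
    (k : ℝ → ℝ → ℝ) (hkm : Measurable (Function.uncurry k))
    (hk0 : ∀ x y : ℝ, 0 < x → 0 < y → 0 ≤ k x y)
    (hhom : ∀ t x y : ℝ, 0 < t → 0 < x → 0 < y → k (t * x) (t * y) = t ^ (-lam) * k x y)
    (hK0 : 0 < ∫⁻ t in Ioi (0 : ℝ), ENNReal.ofReal (k 1 t * t ^ (σ - 1)))
    (hK1 : (∫⁻ t in Ioi (0 : ℝ), ENNReal.ofReal (k 1 t * t ^ (σ - 1))) < ⊤)
    (f g : ℝ → ℝ) (hf : Measurable f) (hg : Measurable g)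
    (hf0 : ∀ x ∈ Ioi (0 : ℝ), 0 ≤ f x) (hg0 : ∀ y ∈ Ioi (0 : ℝ), 0 ≤ g y)
    (hA0 : 0 < ∫⁻ x in Ioi (0 : ℝ), ENNReal.ofReal (x ^ (p * (1 - mu) - 1) * f x ^ p))
    (hA1 : (∫⁻ x in Ioi (0 : ℝ), ENNReal.ofReal (x ^ (p * (1 - mu) - 1) * f x ^ p)) < ⊤)
    (hB0 : 0 < ∫⁻ y in Ioi (0 : ℝ), ENNReal.ofReal (y ^ (q * (1 - σ) - 1) * g y ^ q))
    (hB1 : (∫⁻ y in Ioi (0 : ℝ), ENNReal.ofReal (y ^ (q * (1 - σ) - 1) * g y ^ q)) < ⊤) :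
    (∫⁻ y in Ioi (0 : ℝ), ∫⁻ x in Ioi (0 : ℝ), ENNReal.ofReal (k x y * f x * g y))
      < (∫⁻ t in Ioi (0 : ℝ), ENNReal.ofReal (k 1 t * t ^ (σ - 1))) *
          (∫⁻ x in Ioi (0 : ℝ), ENNReal.ofReal (x ^ (p * (1 - mu) - 1) * f x ^ p)) ^ (1 / p) *
          (∫⁻ y in Ioi (0 : ℝ), ENNReal.ofReal (y ^ (q * (1 - σ) - 1) * g y ^ q)) ^ (1 / q) := by
  have hp0 : 0 < p := one_pos.trans hp
  have hr : 0 < 1 / p := by positivity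
  have hs : 0 < 1 / q := by
    have : 1 / p < 1 := (div_lt_one hp0).2 hp
    linarith
  have hq0 : 0 < q := one_div_pos.1 hs
  have hwone := lintegral_rpow_mul_rpow_div_mul_inv_eq_one hA0 hA1
  have hzone := lintegral_rpow_mul_rpow_div_mul_inv_eq_one hB0 hB1
  set A := ∫⁻ x in Ioi (0 : ℝ), ENNReal.ofReal (x ^ (p * (1 - mu) - 1) * f x ^ p)
  set B := ∫⁻ y in Ioi (0 : ℝ), ENNReal.ofReal (y ^ (q * (1 - σ) - 1) * g y ^ q)
  have hApos : 0 < A.toReal := ENNReal.toReal_pos hA0.ne' hA1.ne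
  have hBpos : 0 < B.toReal := ENNReal.toReal_pos hB0.ne' hB1.ne
  set C := A ^ (1 / p) * B ^ (1 / q) with hC
  have hCr : C = ENNReal.ofReal (A.toReal ^ (1 / p) * B.toReal ^ (1 / q)) := by
    rw [ENNReal.ofReal_mul (by positivity), ← ENNReal.ofReal_rpow_of_pos hApos,
      ← ENNReal.ofReal_rpow_of_pos hBpos, ENNReal.ofReal_toReal hA1.ne,
      ENNReal.ofReal_toReal hB1.ne]
  have hC0 : C ≠ 0 := by
    rw [hCr]
    exact (ENNReal.ofReal_pos.2 (by positivity)).ne'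
  have hCtop : C ≠ ⊤ := hCr ▸ ENNReal.ofReal_ne_top
  set w : ℝ → ℝ := fun x => x ^ (p * (1 - mu)) * f x ^ p / A.toReal with hw
  set z : ℝ → ℝ := fun y => y ^ (q * (1 - σ)) * g y ^ q / B.toReal with hz
  have hwm : Measurable w := by fun_prop
  have hzm : Measurable z := by fun_prop
  have hw0 : ∀ x ∈ Ioi (0 : ℝ), 0 ≤ w x := fun x hx => by
    have := hf0 x hx
    have hx0 : (0 : ℝ) < x := hx
    positivity
  have hz0 : ∀ y ∈ Ioi (0 : ℝ), 0 ≤ z y := fun y hy => by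
    have := hg0 y hy
    have hy0 : (0 : ℝ) < y := hy
    positivity
  have hk1m : Measurable (k 1) := hkm.comp measurable_prodMk_left
  have hKm : Measurable fun t : ℝ => k 1 t * t ^ (σ - 1) := by fun_prop
  have hpoint {x t : ℝ} (hx : 0 < x) (ht : 0 < t) :
      ENNReal.ofReal x * ENNReal.ofReal (k x (x * t) * f x * g (x * t))
        = C * (ENNReal.ofReal (k 1 t * t ^ (σ - 1)) *
          ENNReal.ofReal (w x ^ (1 / p) * z (t * x) ^ (1 / q) * x⁻¹)) := by
    have hk1 : 0 ≤ k 1 t := hk0 1 t one_pos ht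
    have hkx : k x (x * t) = x ^ (-lam) * k 1 t := by
      simpa using hhom x 1 t hx one_pos ht
    rw [hCr, ← ENNReal.ofReal_mul hx.le, ← ENNReal.ofReal_mul (by positivity),
      ← ENNReal.ofReal_mul (by positivity), hkx]
    congr 1
    simp only [hw, hz]
    rw [rpow_mul_rpow_div_rpow_one_div hp0.ne' hx (hf0 x hx) hApos,
      rpow_mul_rpow_div_rpow_one_div hq0.ne' (mul_pos ht hx) (hg0 _ (mul_pos ht hx)) hBpos,
      mul_comm t x, Real.mul_rpow hx.le ht.le]
    have hxpow : x * x ^ (-lam) = x ^ (1 - mu) * x ^ (1 - σ) * x⁻¹ := by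
      have hsum : x ^ (1 + -lam) = x * x ^ (-lam) := by
        rw [Real.rpow_add hx, Real.rpow_one]
      rw [← hsum, ← Real.rpow_add hx, ← Real.rpow_neg_one,
        ← Real.rpow_add hx]
      congr 1
      linarith
    have htpow : t ^ (σ - 1) * t ^ (1 - σ) = 1 := by
      rw [← Real.rpow_add ht]
      simp
    have hAr : A.toReal ^ (1 / p) ≠ 0 := by positivity
    have hBr : B.toReal ^ (1 / q) ≠ 0 := by positivity
    calc x * (x ^ (-lam) * k 1 t * f x * g (x * t))
        = (x * x ^ (-lam)) * (k 1 t * f x * g (x * t)) := by ring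
      _ = (t ^ (σ - 1) * t ^ (1 - σ)) * (x ^ (1 - mu) * x ^ (1 - σ) * x⁻¹)
            * (k 1 t * f x * g (x * t)) := by rw [hxpow, htpow, one_mul]
      _ = _ := by field_simp
  calc ∫⁻ y in Ioi (0 : ℝ), ∫⁻ x in Ioi (0 : ℝ), ENNReal.ofReal (k x y * f x * g y)
      = ∫⁻ x in Ioi (0 : ℝ), ∫⁻ y in Ioi (0 : ℝ), ENNReal.ofReal (k x y * f x * g y) := by
        refine lintegral_lintegral_swap (Measurable.aemeasurable ?_)
        have : Measurable fun a : ℝ × ℝ => k a.2 a.1 := hkm.comp measurable_swap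
        simp only [Function.uncurry_def]
        fun_prop
    _ = ∫⁻ x in Ioi (0 : ℝ), ∫⁻ t in Ioi (0 : ℝ), C *
          (ENNReal.ofReal (k 1 t * t ^ (σ - 1)) *
            ENNReal.ofReal (w x ^ (1 / p) * z (t * x) ^ (1 / q) * x⁻¹)) := by
        refine setLIntegral_congr_fun measurableSet_Ioi fun x hx => ?_
        have hscale := lintegral_Ioi_mul_left (mem_Ioi.1 hx) 0
          fun y => ENNReal.ofReal (k x y * f x * g y)
        rw [mul_zero] at hscale
        exact hscale.trans (setLIntegral_congr_fun measurableSet_Ioi fun t ht => hpoint hx ht)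
    _ = ∫⁻ t in Ioi (0 : ℝ), ∫⁻ x in Ioi (0 : ℝ), C *
          (ENNReal.ofReal (k 1 t * t ^ (σ - 1)) *
            ENNReal.ofReal (w x ^ (1 / p) * z (t * x) ^ (1 / q) * x⁻¹)) := by
        refine lintegral_lintegral_swap (Measurable.aemeasurable ?_)
        simp only [Function.uncurry_def]
        fun_prop
    _ = C * ∫⁻ t in Ioi (0 : ℝ), ENNReal.ofReal (k 1 t * t ^ (σ - 1)) *
          ∫⁻ x in Ioi (0 : ℝ),
            ENNReal.ofReal (w x ^ (1 / p) * z (t * x) ^ (1 / q) * x⁻¹) := by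
        rw [← lintegral_const_mul' _ _ hCtop]
        refine lintegral_congr fun t => ?_
        rw [lintegral_const_mul' _ _ hCtop, lintegral_const_mul' _ _ ENNReal.ofReal_ne_top]
    _ < C * ∫⁻ t in Ioi (0 : ℝ), ENNReal.ofReal (k 1 t * t ^ (σ - 1)) :=
        (ENNReal.mul_lt_mul_iff_right hC0 hCtop).2
          (lintegral_mul_lintegral_rpow_mul_rpow_lt hr hs hpq hwm hzm hw0 hz0 hwone hzone hKm
            hK0.ne' hK1.ne)
    _ = _ := by rw [mul_comm, hC, mul_assoc]
end

section
/- Let p > 1 and let q satisfy 1/p + 1/q = 1, let σ ∈ ℝ, and let h be a nonnegative Lebesgue-measurable function on (0,∞) with k⁽¹⁾(σ) := ∫₀^1 h(t) t^{σ-1} dt satisfying 0 < k⁽¹⁾(σ) < ∞. Let f, g be nonnegative measurable functions on (0,∞) such that 0 < ∫₀^∞ x^{p(1−σ)−1} f(x)^p dx < ∞ and 0 < ∫₀^∞ y^{q(1−σ)−1} g(y)^q dy < ∞. Then ∫₀^∞ (∫₀^{1/y} h(x·y) f(x) dx) g(y) dy < k⁽¹⁾(σ) · (∫₀^∞ x^{p(1−σ)−1}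 f(x)^p dx)^{1/p} · (∫₀^∞ y^{q(1−σ)−1} g(y)^q dy)^{1/q}, where the inner integral is over x ∈ (0, 1/y). -/
open MeasureTheory Set

open scoped ENNReal

theorem ENNReal.rpow_mul_rpow_le_and_eq_of_eq {a b : ℝ} (ha : 0 < a) (hb : 0 < b)
    (hab : a + b = 1) {x y : ℝ≥0∞} (hx : x ≠ ∞) (hy : y ≠ ∞) :
    x ^ a * y ^ b ≤ ENNReal.ofReal a * x + ENNReal.ofReal b * y ∧
      (x ^ a * y ^ b = ENNReal.ofReal a * x + ENNReal.ofReal b * y → x = y) := by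
  lift x to NNReal using hx
  lift y to NNReal using hy
  lift a to NNReal using ha.le
  lift b to NNReal using hb.le
  have hab' : a + b = 1 := by exact_mod_cast hab
  rw [ENNReal.ofReal_coe_nnreal, ENNReal.ofReal_coe_nnreal,
    ← ENNReal.coe_rpow_of_nonneg _ ha.le, ← ENNReal.coe_rpow_of_nonneg _ hb.le]
  norm_cast
  refine ⟨NNReal.geom_mean_le_arith_mean2_weighted a b x y hab', fun h => ?_⟩
  have key := Real.geom_mean_eq_arith_mean_weighted_iff_of_pos (Finset.univ : Finset (Fin 2))
    ![(a : ℝ), b] ![(x : ℝ), y] (by simpa [Fin.forall_fin_two] using ⟨ha, hb⟩)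
    (by simpa using hab) (by simp [Fin.forall_fin_two])
  have h' : (x : ℝ) ^ (a : ℝ) * (y : ℝ) ^ (b : ℝ) = a * x + b * y := by exact_mod_cast h
  simpa using key.1 (by simpa using h') 0 (Finset.mem_univ _) 1 (Finset.mem_univ _)

/-- Hölder's inequality for `∫⁻ u ^ a * v ^ b`, together with its equality case. -/
theorem lintegral_rpow_mul_rpow_le_and_ae_eq_of_eq {α : Type*} [MeasurableSpace α] {μ : Measure α}
    {a b : ℝ} (ha : 0 < a) (hb : 0 < b) (hab : a + b = 1) {u v : α → ℝ≥0∞}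
    (hu : Measurable u) (hv : Measurable v) (hu' : ∀ x, u x ≠ ∞) (hv' : ∀ x, v x ≠ ∞)
    (hA0 : ∫⁻ x, u x ∂μ ≠ 0) (hA1 : ∫⁻ x, u x ∂μ ≠ ∞)
    (hB0 : ∫⁻ x, v x ∂μ ≠ 0) (hB1 : ∫⁻ x, v x ∂μ ≠ ∞) :
    ∫⁻ x, u x ^ a * v x ^ b ∂μ ≤ (∫⁻ x, u x ∂μ) ^ a * (∫⁻ x, v x ∂μ) ^ b ∧
      (∫⁻ x, u x ^ a * v x ^ b ∂μ = (∫⁻ x, u x ∂μ) ^ a * (∫⁻ x, v x ∂μ) ^ b →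
        ∀ᵐ x ∂μ, u x * (∫⁻ x, u x ∂μ)⁻¹ = v x * (∫⁻ x, v x ∂μ)⁻¹) := by
  set A := ∫⁻ x, u x ∂μ with hA
  set B := ∫⁻ x, v x ∂μ with hB
  have hAi : A⁻¹ ≠ ∞ := ENNReal.inv_ne_top.2 hA0
  have hBi : B⁻¹ ≠ ∞ := ENNReal.inv_ne_top.2 hB0
  have young := fun x => ENNReal.rpow_mul_rpow_le_and_eq_of_eq ha hb hab
    (ENNReal.mul_ne_top (hu' x) hAi) (ENNReal.mul_ne_top (hv' x) hBi)
  have hC0 : A ^ a * B ^ b ≠ 0 :=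
    mul_ne_zero (ENNReal.rpow_pos (pos_iff_ne_zero.2 hA0) hA1).ne'
      (ENNReal.rpow_pos (pos_iff_ne_zero.2 hB0) hB1).ne'
  have hC1 : A ^ a * B ^ b ≠ ∞ :=
    ENNReal.mul_ne_top (ENNReal.rpow_ne_top_of_nonneg ha.le hA1)
      (ENNReal.rpow_ne_top_of_nonneg hb.le hB1)
  have hgeom : ∫⁻ x, (u x * A⁻¹) ^ a * (v x * B⁻¹) ^ b ∂μ =
      (∫⁻ x, u x ^ a * v x ^ b ∂μ) * (A ^ a * B ^ b)⁻¹ := by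
    rw [← lintegral_mul_const _ (by fun_prop)]
    refine lintegral_congr fun x => ?_
    rw [ENNReal.mul_rpow_of_nonneg _ _ ha.le, ENNReal.mul_rpow_of_nonneg _ _ hb.le,
      ENNReal.inv_rpow, ENNReal.inv_rpow, ENNReal.mul_inv
        (Or.inr (ENNReal.rpow_ne_top_of_nonneg hb.le hB1))
        (Or.inl (ENNReal.rpow_ne_top_of_nonneg ha.le hA1))]
    ring
  have harith : ∫⁻ x, (ENNReal.ofReal a * (u x * A⁻¹) + ENNReal.ofReal b * (v x * B⁻¹)) ∂μ
      = 1 := by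
    rw [lintegral_add_left (by fun_prop), lintegral_const_mul _ (by fun_prop),
      lintegral_const_mul _ (by fun_prop), lintegral_mul_const _ hu, lintegral_mul_const _ hv,
      ← hA, ← hB, ENNReal.mul_inv_cancel hA0 hA1, ENNReal.mul_inv_cancel hB0 hB1, mul_one,
      mul_one, ← ENNReal.ofReal_add ha.le hb.le, hab, ENNReal.ofReal_one]
  have hle : ∫⁻ x, (u x * A⁻¹) ^ a * (v x * B⁻¹) ^ b ∂μ ≤ 1 :=
    harith ▸ lintegral_mono fun x => (young x).1
  refine ⟨?_, fun heq => ?_⟩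
  · rw [hgeom, ← div_eq_mul_inv] at hle
    simpa using (ENNReal.div_le_iff hC0 hC1).1 hle
  · have h1 : ∫⁻ x, (u x * A⁻¹) ^ a * (v x * B⁻¹) ^ b ∂μ = 1 := by
      rw [hgeom, heq, ENNReal.mul_inv_cancel hC0 hC1]
    filter_upwards [ae_eq_of_ae_le_of_lintegral_le (ae_of_all μ fun x => (young x).1)
      (h1 ▸ ENNReal.one_ne_top) (by fun_prop) (harith.trans h1.symm).le] with x hx
    exact (young x).2 hx

theorem lintegral_Ioi_comp_const_div {t : ℝ} (ht : 0 < t) (φ : ℝ → ℝ≥0∞) :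
    ∫⁻ y in Ioi (0 : ℝ), ENNReal.ofReal (t / y ^ 2) * φ (t / y) = ∫⁻ x in Ioi (0 : ℝ), φ x := by
  have himg : (fun y : ℝ => t / y) '' Ioi 0 = Ioi 0 := by
    ext x
    constructor
    · rintro ⟨y, hy, rfl⟩
      exact div_pos ht hy
    · intro hx
      exact ⟨t / x, div_pos ht hx, div_div_cancel₀ ht.ne'⟩
  have hderiv : ∀ y ∈ Ioi (0 : ℝ),
      HasDerivWithinAt (fun y : ℝ => t / y) (-(t / y ^ 2)) (Ioi 0) y := by
    intro y hy
    have := ((hasDerivAt_inv (ne_of_gt hy)).const_mul t).hasDerivWithinAt (s := Ioi 0)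
    convert! this using 1
    simp [div_eq_mul_inv]
  have hinj : InjOn (fun y : ℝ => t / y) (Ioi 0) := by
    intro x _ y _ hxy
    simpa [div_eq_mul_inv, ht.ne'] using hxy
  have := lintegral_image_eq_lintegral_abs_deriv_mul measurableSet_Ioi hderiv hinj φ
  rw [himg] at this
  rw [this]
  refine setLIntegral_congr_fun measurableSet_Ioi fun y hy => ?_
  simp only [abs_neg]
  rw [abs_of_pos (div_pos ht (pow_pos hy 2))]

theorem lintegral_Ioo_comp_div_const {y : ℝ} (hy : 0 < y) (φ : ℝ → ℝ≥0∞) :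
    ∫⁻ t in Ioo (0 : ℝ) 1, ENNReal.ofReal (1 / y) * φ (t / y) =
      ∫⁻ x in Ioo (0 : ℝ) (1 / y), φ x := by
  have himg : (fun t : ℝ => t / y) '' Ioo 0 1 = Ioo 0 (1 / y) := by
    ext x
    constructor
    · rintro ⟨t, ⟨ht0, ht1⟩, rfl⟩
      exact ⟨div_pos ht0 hy, div_lt_div_of_pos_right ht1 hy⟩
    · rintro ⟨hx0, hx1⟩
      exact ⟨x * y, ⟨mul_pos hx0 hy, (lt_div_iff₀ hy).1 hx1⟩, mul_div_cancel_right₀ x hy.ne'⟩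
  have hderiv : ∀ t ∈ Ioo (0 : ℝ) 1,
      HasDerivWithinAt (fun t : ℝ => t / y) (1 / y) (Ioo 0 1) t :=
    fun t _ => ((hasDerivAt_id t).div_const y).hasDerivWithinAt
  have hinj : InjOn (fun t : ℝ => t / y) (Ioo 0 1) := by
    intro s _ t _ hst
    simpa [div_eq_mul_inv, hy.ne'] using hst
  have := lintegral_image_eq_lintegral_abs_deriv_mul measurableSet_Ioo hderiv hinj φ
  rw [← himg, this, abs_of_pos (one_div_pos.2 hy)]

/-- An integrable density on `(0, ∞)` that is invariant under a nontrivial dilation vanishes. -/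
theorem lintegral_Ioi_eq_zero_of_dilation_invariant {t₁ t₂ : ℝ} (ht₁ : 0 < t₁) (ht : t₁ < t₂)
    {φ : ℝ → ℝ≥0∞} (hφ : ∫⁻ x in Ioi (0 : ℝ), φ x ≠ ∞)
    (hinv : ∀ᵐ y ∂volume.restrict (Ioi (0 : ℝ)),
      ENNReal.ofReal (t₁ / y ^ 2) * φ (t₁ / y) = ENNReal.ofReal (t₂ / y ^ 2) * φ (t₂ / y)) :
    ∫⁻ x in Ioi (0 : ℝ), φ x = 0 := by
  have ht₂ : 0 < t₂ := ht₁.trans ht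
  set ν := (volume.restrict (Ioi (0 : ℝ))).withDensity φ with hν
  have hνuniv : ν univ = ∫⁻ x in Ioi (0 : ℝ), φ x := by
    rw [hν, withDensity_apply _ MeasurableSet.univ, Measure.restrict_univ]
  have hνfin : IsFiniteMeasure ν := ⟨by rw [hνuniv]; exact hφ.lt_top⟩
  have tail : ∀ t, 0 < t → ∀ r, ν (Ioi (t * r)) = ∫⁻ y in Ioi (0 : ℝ),
      (Iio (1 / y)).indicator (fun _ => ENNReal.ofReal (t / y ^ 2) * φ (t / y)) r := by
    intro t ht0 r
    rw [hν, withDensity_apply _ measurableSet_Ioi, ← lintegral_indicator measurableSet_Ioi,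
      ← lintegral_Ioi_comp_const_div ht0]
    refine lintegral_congr fun y => ?_
    have : t * r < t / y ↔ r < 1 / y := by
      rw [div_eq_mul_inv, mul_lt_mul_iff_right₀ ht0, one_div]
    by_cases h : r < 1 / y <;> simp only [indicator, mem_Ioi, mem_Iio, this, h, if_true, if_false,
      mul_zero]
  have tail_eq : ∀ r, ν (Ioi (t₁ * r)) = ν (Ioi (t₂ * r)) := by
    intro r
    rw [tail t₁ ht₁, tail t₂ ht₂]
    refine lintegral_congr_ae ?_
    filter_upwards [hinv] with y hy
    simp only [hy]
  set s := t₂ / t₁ with hs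
  have hs1 : 1 < s := (one_lt_div ht₁).2 ht
  have hnull : ∀ n : ℤ, ν (Ioc (s ^ n) (s ^ (n + 1))) = 0 := by
    intro n
    have hmono : s ^ n ≤ s ^ (n + 1) := zpow_le_zpow_right₀ hs1.le (by lia)
    have h1 := tail_eq (s ^ n / t₁)
    have h2 : t₁ * (s ^ n / t₁) = s ^ n := by field_simp
    have h3 : t₂ * (s ^ n / t₁) = s ^ (n + 1) := by
      rw [zpow_add_one₀ (by positivity), hs]
      ring
    rw [h2, h3] at h1
    rw [← Ioi_sdiff_Ioi, measure_sdiff (Ioi_subset_Ioi hmono) measurableSet_Ioi.nullMeasurableSet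
      (measure_ne_top _ _), h1, tsub_self]
  have hIoi : ν (Ioi 0) = 0 := by
    refine measure_mono_null (fun x hx => ?_) (measure_iUnion_null hnull)
    exact mem_iUnion.2 (exists_mem_Ioc_zpow hx hs1)
  rwa [hν, withDensity_apply _ measurableSet_Ioi, Measure.restrict_restrict measurableSet_Ioi,
    inter_self] at hIoi

theorem lintegral_Ioi_lintegral_Ioo_one_div_eq {H F G : ℝ → ℝ≥0∞} (hH : Measurable H)
    (hF : Measurable F) (hG : Measurable G) :
    ∫⁻ y in Ioi (0 : ℝ), (∫⁻ x in Ioo (0 : ℝ) (1 / y), H (x * y) * F x) * G y =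
      ∫⁻ t in Ioo (0 : ℝ) 1, H t *
        ∫⁻ y in Ioi (0 : ℝ), ENNReal.ofReal (1 / y) * F (t / y) * G y := by
  have inner : ∀ y ∈ Ioi (0 : ℝ), (∫⁻ x in Ioo (0 : ℝ) (1 / y), H (x * y) * F x) * G y =
      ∫⁻ t in Ioo (0 : ℝ) 1, H t * (ENNReal.ofReal (1 / y) * F (t / y) * G y) := by
    intro y hy
    have hy0 : (0 : ℝ) < y := hy
    rw [← lintegral_Ioo_comp_div_const hy0, ← lintegral_mul_const _ (by fun_prop)]
    refine lintegral_congr fun t => ?_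
    rw [div_mul_cancel₀ t hy0.ne']
    ring
  rw [setLIntegral_congr_fun measurableSet_Ioi inner, lintegral_lintegral_swap (by fun_prop)]
  refine lintegral_congr fun t => ?_
  rw [lintegral_const_mul _ (by fun_prop)]

theorem one_div_mul_eq_rpow_mul_rpow {p q σ t y c d : ℝ} (hp : 1 < p) (hq : 0 < q)
    (hpq : 1 / p + 1 / q = 1) (ht : 0 < t) (hy : 0 < y) (hc : 0 ≤ c) (hd : 0 ≤ d) :
    1 / y * c * d = t ^ (σ - 1) *
      ((t / y ^ 2 * ((t / y) ^ (p * (1 - σ) - 1) * c ^ p)) ^ (1 / p) *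
        (y ^ (q * (1 - σ) - 1) * d ^ q) ^ (1 / q)) := by
  have hp0 : 0 < p := one_pos.trans hp
  have hcp : (c ^ p) ^ (1 / p) = c := by rw [one_div, Real.rpow_rpow_inv hc hp0.ne']
  have hdq : (d ^ q) ^ (1 / q) = d := by rw [one_div, Real.rpow_rpow_inv hd hq.ne']
  rw [Real.mul_rpow (by positivity) (by positivity), Real.mul_rpow (by positivity) (by positivity),
    Real.mul_rpow (by positivity) (by positivity), hcp, hdq]
  obtain ⟨α, rfl⟩ : ∃ α, Real.exp α = t := ⟨_, Real.exp_log ht⟩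
  obtain ⟨β, rfl⟩ : ∃ β, Real.exp β = y := ⟨_, Real.exp_log hy⟩
  have hsq : Real.exp β ^ 2 = Real.exp (2 * β) := by rw [← Real.exp_nat_mul]; norm_num
  have hexp : Real.exp (-β) = Real.exp (α * (σ - 1)) * (Real.exp ((α - 2 * β) * (1 / p)) *
      Real.exp ((α - β) * (p * (1 - σ) - 1) * (1 / p)) *
        Real.exp (β * (q * (1 - σ) - 1) * (1 / q))) := by
    rw [← Real.exp_add, ← Real.exp_add, ← Real.exp_add]
    congr 1
    have h1 : p * (1 / p) = 1 := mul_one_div_cancel hp0.ne'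
    have h2 : q * (1 / q) = 1 := mul_one_div_cancel hq.ne'
    linear_combination β * hpq - (α - β) * (1 - σ) * h1 - β * (1 - σ) * h2
  rw [hsq, ← Real.exp_sub, ← Real.exp_sub, one_div (Real.exp β), ← Real.exp_neg, hexp]
  simp only [← Real.exp_mul]
  ring

/-- First-kind Hardy-type inequality with non-homogeneous kernel:
`∫₀^∞ (∫₀^{1/y} h(xy) f(x) dx) g(y) dy
  < k⁽¹⁾(σ) (∫₀^∞ x^{p(1-σ)-1} f^p)^{1/p} (∫₀^∞ y^{q(1-σ)-1} g^q)^{1/q}`,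
where `k⁽¹⁾(σ) = ∫₀^1 h(t) t^{σ-1} dt`. -/
theorem stmt11 (p q σ : ℝ) (hp : 1 < p) (hpq : 1 / p + 1 / q = 1)
    (h : ℝ → ℝ) (hh : Measurable h) (hh0 : ∀ t ∈ Ioi (0 : ℝ), 0 ≤ h t)
    (hk0 : 0 < ∫⁻ t in Ioo (0 : ℝ) 1, ENNReal.ofReal (h t * t ^ (σ - 1)))
    (hk1 : (∫⁻ t in Ioo (0 : ℝ) 1, ENNReal.ofReal (h t * t ^ (σ - 1))) < ⊤)
    (f g : ℝ → ℝ) (hf : Measurable f) (hg : Measurable g)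
    (hf0 : ∀ x ∈ Ioi (0 : ℝ), 0 ≤ f x) (hg0 : ∀ y ∈ Ioi (0 : ℝ), 0 ≤ g y)
    (hA0 : 0 < ∫⁻ x in Ioi (0 : ℝ), ENNReal.ofReal (x ^ (p * (1 - σ) - 1) * f x ^ p))
    (hA1 : (∫⁻ x in Ioi (0 : ℝ), ENNReal.ofReal (x ^ (p * (1 - σ) - 1) * f x ^ p)) < ⊤)
    (hB0 : 0 < ∫⁻ y in Ioi (0 : ℝ), ENNReal.ofReal (y ^ (q * (1 - σ) - 1) * g y ^ q))
    (hB1 : (∫⁻ y in Ioi (0 : ℝ), ENNReal.ofReal (y ^ (q * (1 - σ) - 1) * g y ^ q)) < ⊤) :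
    (∫⁻ y in Ioi (0 : ℝ),
        (∫⁻ x in Ioo (0 : ℝ) (1 / y), ENNReal.ofReal (h (x * y) * f x)) *
          ENNReal.ofReal (g y))
      < (∫⁻ t in Ioo (0 : ℝ) 1, ENNReal.ofReal (h t * t ^ (σ - 1))) *
          (∫⁻ x in Ioi (0 : ℝ), ENNReal.ofReal (x ^ (p * (1 - σ) - 1) * f x ^ p)) ^ (1 / p) *
          (∫⁻ y in Ioi (0 : ℝ), ENNReal.ofReal (y ^ (q * (1 - σ) - 1) * g y ^ q)) ^ (1 / q) := by
  have hp0 : 0 < p := one_pos.trans hp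
  have ha : 0 < 1 / p := one_div_pos.2 hp0
  have hb : 0 < 1 / q := by
    have : 1 / p < 1 := (div_lt_one hp0).2 hp
    linarith
  have hq : 0 < q := one_div_pos.1 hb
  set u : ℝ → ℝ≥0∞ := fun x => ENNReal.ofReal (x ^ (p * (1 - σ) - 1) * f x ^ p) with hu
  set v : ℝ → ℝ≥0∞ := fun y => ENNReal.ofReal (y ^ (q * (1 - σ) - 1) * g y ^ q) with hv
  set w : ℝ → ℝ≥0∞ := fun t => ENNReal.ofReal (h t * t ^ (σ - 1)) with hw
  set U : ℝ → ℝ → ℝ≥0∞ := fun t y => ENNReal.ofReal (t / y ^ 2) * u (t / y) with hU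
  set A := ∫⁻ x in Ioi (0 : ℝ), u x with hA
  set B := ∫⁻ y in Ioi (0 : ℝ), v y with hB
  have hum : Measurable u := by fun_prop
  have hvm : Measurable v := by fun_prop
  have hwm : Measurable w := by fun_prop
  have hUA : ∀ t, 0 < t → ∫⁻ y in Ioi (0 : ℝ), U t y = A :=
    fun t ht => lintegral_Ioi_comp_const_div ht u
  set J : ℝ → ℝ≥0∞ := fun t => ∫⁻ y in Ioi (0 : ℝ), U t y ^ (1 / p) * v y ^ (1 / q) with hJ
  set C := A ^ (1 / p) * B ^ (1 / q) with hC
  have hC1 : C ≠ ⊤ := ENNReal.mul_ne_top (ENNReal.rpow_ne_top_of_nonneg ha.le hA1.ne)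
    (ENNReal.rpow_ne_top_of_nonneg hb.le hB1.ne)
  have holder : ∀ t, 0 < t → J t ≤ C ∧ (J t = C →
      ∀ᵐ y ∂volume.restrict (Ioi (0 : ℝ)), U t y * A⁻¹ = v y * B⁻¹) := by
    intro t ht
    have := lintegral_rpow_mul_rpow_le_and_ae_eq_of_eq (μ := volume.restrict (Ioi (0 : ℝ))) ha hb hpq
      (u := U t) (by fun_prop) hvm
      (fun y => ENNReal.mul_ne_top ENNReal.ofReal_ne_top ENNReal.ofReal_ne_top)
      (fun y => ENNReal.ofReal_ne_top) (by rw [hUA t ht]; exact hA0.ne')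
      (by rw [hUA t ht]; exact hA1.ne) hB0.ne' hB1.ne
    rwa [hUA t ht] at this
  have not_eq_of_lt : ∀ t₁ t₂, 0 < t₁ → t₁ < t₂ → J t₁ = C → J t₂ = C → False := by
    intro t₁ t₂ ht₁ ht h₁ h₂
    refine hA0.ne' (lintegral_Ioi_eq_zero_of_dilation_invariant ht₁ ht hA1.ne ?_)
    filter_upwards [(holder t₁ ht₁).2 h₁, (holder t₂ (ht₁.trans ht)).2 h₂] with y hy₁ hy₂
    exact (ENNReal.mul_left_inj (ENNReal.inv_ne_zero.2 hA1.ne)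
      (ENNReal.inv_ne_top.2 hA0.ne')).1 (hy₁.trans hy₂.symm)
  have hsub : {t | 0 < t ∧ J t = C}.Subsingleton := by
    rintro t₁ ⟨ht₁, h₁⟩ t₂ ⟨ht₂, h₂⟩
    rcases lt_trichotomy t₁ t₂ with hlt | heq | hlt
    · exact (not_eq_of_lt t₁ t₂ ht₁ hlt h₁ h₂).elim
    · exact heq
    · exact (not_eq_of_lt t₂ t₁ ht₂ hlt h₂ h₁).elim
  have hne : ∀ᵐ t ∂volume.restrict (Ioo (0 : ℝ) 1), ¬ (0 < t ∧ J t = C) :=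
    ae_restrict_of_ae (measure_eq_zero_iff_ae_notMem.1 (hsub.measure_zero volume))
  have hpos : ∀ᵐ t ∂volume.restrict (Ioo (0 : ℝ) 1), 0 < t :=
    (ae_restrict_mem measurableSet_Ioo).mono fun t ht => ht.1
  have hle : (fun t => w t * J t) ≤ᵐ[volume.restrict (Ioo (0 : ℝ) 1)] fun t => w t * C :=
    hpos.mono fun t ht => mul_le_mul_right (holder t ht).1 _
  have hwC : ∫⁻ t in Ioo (0 : ℝ) 1, w t * C = (∫⁻ t in Ioo (0 : ℝ) 1, w t) * C :=
    lintegral_mul_const _ hwm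
  have hfreq : ∃ᵐ t ∂volume.restrict (Ioo (0 : ℝ) 1), w t * J t ≠ w t * C := by
    have hw0 : ∃ᵐ t ∂volume.restrict (Ioo (0 : ℝ) 1), w t ≠ 0 := by
      intro hcon
      refine hk0.ne' ((lintegral_eq_zero_iff hwm).2 ?_)
      exact hcon.mono fun t ht => not_not.1 ht
    refine (hw0.and_eventually (hne.and hpos)).mono ?_
    rintro t ⟨hwt, hnt, ht⟩ heq
    exact hnt ⟨ht, (ENNReal.mul_right_inj hwt ENNReal.ofReal_ne_top).1 heq⟩
  have hlhs : (∫⁻ y in Ioi (0 : ℝ),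
      (∫⁻ x in Ioo (0 : ℝ) (1 / y), ENNReal.ofReal (h (x * y) * f x)) * ENNReal.ofReal (g y)) =
      ∫⁻ t in Ioo (0 : ℝ) 1, w t * J t := by
    calc
      _ = ∫⁻ y in Ioi (0 : ℝ), (∫⁻ x in Ioo (0 : ℝ) (1 / y),
            ENNReal.ofReal (h (x * y)) * ENNReal.ofReal (f x)) * ENNReal.ofReal (g y) := by
        refine setLIntegral_congr_fun measurableSet_Ioi fun y hy => ?_
        refine congrArg (· * ENNReal.ofReal (g y)) ?_
        exact setLIntegral_congr_fun measurableSet_Ioo fun x hx =>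
          ENNReal.ofReal_mul (hh0 _ (mul_pos hx.1 hy))
      _ = ∫⁻ t in Ioo (0 : ℝ) 1, ENNReal.ofReal (h t) * ∫⁻ y in Ioi (0 : ℝ),
            ENNReal.ofReal (1 / y) * ENNReal.ofReal (f (t / y)) * ENNReal.ofReal (g y) :=
        lintegral_Ioi_lintegral_Ioo_one_div_eq (H := fun t => ENNReal.ofReal (h t))
          (F := fun x => ENNReal.ofReal (f x)) (G := fun y => ENNReal.ofReal (g y))
          (by fun_prop) (by fun_prop) (by fun_prop)
      _ = ∫⁻ t in Ioo (0 : ℝ) 1, w t * J t := by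
        refine setLIntegral_congr_fun measurableSet_Ioo fun t ht => ?_
        have ht0 : 0 < t := ht.1
        simp only [hw, hJ]
        rw [ENNReal.ofReal_mul (hh0 t ht0), mul_assoc]
        refine congrArg (ENNReal.ofReal (h t) * ·) ?_
        rw [← lintegral_const_mul _ (by fun_prop)]
        refine setLIntegral_congr_fun measurableSet_Ioi fun y hy => ?_
        have hy0 : 0 < y := hy
        have hc : 0 ≤ f (t / y) := hf0 _ (div_pos ht0 hy0)
        have hd : 0 ≤ g y := hg0 y hy
        simp only [hU, hu, hv]
        rw [← ENNReal.ofReal_mul (by positivity), ← ENNReal.ofReal_mul (by positivity),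
          ← ENNReal.ofReal_mul (by positivity),
          ENNReal.ofReal_rpow_of_nonneg (by positivity) ha.le,
          ENNReal.ofReal_rpow_of_nonneg (by positivity) hb.le,
          ← ENNReal.ofReal_mul (by positivity), ← ENNReal.ofReal_mul (by positivity),
          ← one_div_mul_eq_rpow_mul_rpow hp hq hpq ht0 hy0 hc hd]
  rw [hlhs, mul_assoc, ← hC, ← hwC]
  refine lintegral_strict_mono_of_ae_le_of_frequently_ae_lt (by fun_prop) ?_ hle hfreq
  exact ((lintegral_mono_ae hle).trans_lt (hwC ▸ ENNReal.mul_lt_top hk1 hC1.lt_top)).ne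
end
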